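/- arXiv:1607.02087 — 7 statements merged into one kernel-verified Lean document; each statement's English description precedes it below -/
import Mathlib

section
/- For every integer k ≥ 1 there exists a triple (a₁*, a₂*, a₃*) of real numbers with 0 < a₁* ≤ a₂* ≤ a₃* and a₁*·a₂*·a₃* = 1 such that λ_k(a₁*, a₂*, a₃*) ≤ λ_k(a₁, a₂, a₃) for every triple of real numbers 0 < a₁ ≤ a₂ ≤ a₃ with a₁·a₂·a₃ = 1. In other words, the infimum of λ_k over cuboids of unit measure is attained. -/
/-- The Dirichlet eigenvalue counting function of the cuboid `(0,a₁)×(0,a₂)×(0,a₃)`: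
the number of triples `(i₁,i₂,i₃) ∈ ℤ³` with `i₁,i₂,i₃ ≥ 1` and
`π²(i₁²/a₁² + i₂²/a₂² + i₃²/a₃²) ≤ lam`. -/
noncomputable def cuboidCount (a₁ a₂ a₃ lam : ℝ) : ℕ :=
  Nat.card {p : ℤ × ℤ × ℤ //
    1 ≤ p.1 ∧ 1 ≤ p.2.1 ∧ 1 ≤ p.2.2 ∧
    Real.pi ^ 2 * ((p.1 : ℝ) ^ 2 / a₁ ^ 2 + (p.2.1 : ℝ) ^ 2 / a₂ ^ 2
      + (p.2.2 : ℝ) ^ 2 / a₃ ^ 2) ≤ lam}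

/-- `cuboidEig a₁ a₂ a₃ k` is the `k`-th smallest Dirichlet eigenvalue (counted with
multiplicity) of the cuboid `(0,a₁)×(0,a₂)×(0,a₃)`, expressed as the least `lam` whose
eigenvalue count is at least `k`. -/
noncomputable def cuboidEig (a₁ a₂ a₃ : ℝ) (k : ℕ) : ℝ :=
  sInf {lam : ℝ | k ≤ cuboidCount a₁ a₂ a₃ lam}

/-- `(a₁,a₂,a₃)` is a minimiser for `λ_k` among cuboids of unit measure. -/
noncomputable def IsMinimiser (k : ℕ) (a₁ a₂ a₃ : ℝ) : Prop :=
  0 < a₁ ∧ a₁ ≤ a₂ ∧ a₂ ≤ a₃ ∧ a₁ * a₂ * a₃ = 1 ∧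
    ∀ b₁ b₂ b₃ : ℝ, 0 < b₁ → b₁ ≤ b₂ → b₂ ≤ b₃ → b₁ * b₂ * b₃ = 1 →
      cuboidEig a₁ a₂ a₃ k ≤ cuboidEig b₁ b₂ b₃ k

namespace CuboidAux

/-- The eigenvalue with index `p`. -/
noncomputable def f (a : ℝ × ℝ × ℝ) (p : ℤ × ℤ × ℤ) : ℝ :=
  Real.pi ^ 2 * ((p.1 : ℝ) ^ 2 / a.1 ^ 2 + (p.2.1 : ℝ) ^ 2 / a.2.1 ^ 2
      + (p.2.2 : ℝ) ^ 2 / a.2.2 ^ 2)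

/-- Positive index triples. -/
def Pos (p : ℤ × ℤ × ℤ) : Prop := 1 ≤ p.1 ∧ 1 ≤ p.2.1 ∧ 1 ≤ p.2.2

/-- Index set below `lam`. -/
def P (a : ℝ × ℝ × ℝ) (lam : ℝ) : Set (ℤ × ℤ × ℤ) := {p | Pos p ∧ f a p ≤ lam}

lemma count_eq (a : ℝ × ℝ × ℝ) (lam : ℝ) :
    cuboidCount a.1 a.2.1 a.2.2 lam = (P a lam).ncard := by
  unfold cuboidCount
  rw [← Nat.card_coe_set_eq]
  refine Nat.card_congr (Equiv.subtypeEquivRight ?_)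
  intro p
  simp only [P, Pos, f, Set.mem_ofPred_eq, and_assoc]

lemma f_nonneg (a : ℝ × ℝ × ℝ) (p : ℤ × ℤ × ℤ) : 0 ≤ f a p := by
  unfold f; positivity

/-- Each index is bounded when the eigenvalue is. -/
lemma coord_bound {a : ℝ × ℝ × ℝ} (h1 : 0 < a.1) (h2 : 0 < a.2.1) (h3 : 0 < a.2.2)
    {p : ℤ × ℤ × ℤ} {lam : ℝ} (h : f a p ≤ lam) :
    Real.pi ^ 2 * (p.1 : ℝ) ^ 2 ≤ lam * a.1 ^ 2 ∧
    Real.pi ^ 2 * (p.2.1 : ℝ) ^ 2 ≤ lam * a.2.1 ^ 2 ∧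
    Real.pi ^ 2 * (p.2.2 : ℝ) ^ 2 ≤ lam * a.2.2 ^ 2 := by
  unfold f at h
  have hp := sq_nonneg Real.pi
  have e1 : 0 ≤ Real.pi ^ 2 * ((p.1 : ℝ) ^ 2 / a.1 ^ 2) := by positivity
  have e2 : 0 ≤ Real.pi ^ 2 * ((p.2.1 : ℝ) ^ 2 / a.2.1 ^ 2) := by positivity
  have e3 : 0 ≤ Real.pi ^ 2 * ((p.2.2 : ℝ) ^ 2 / a.2.2 ^ 2) := by positivity
  refine ⟨?_, ?_, ?_⟩
  · rw [← div_le_iff₀ (by positivity), mul_div_assoc]; linarith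
  · rw [← div_le_iff₀ (by positivity), mul_div_assoc]; linarith
  · rw [← div_le_iff₀ (by positivity), mul_div_assoc]; linarith

lemma one_le_pi_sq : 1 ≤ Real.pi ^ 2 := by nlinarith [Real.pi_gt_three]

lemma le_of_sq {n : ℤ} {B : ℝ} (hn : 1 ≤ n) (h : Real.pi ^ 2 * (n : ℝ) ^ 2 ≤ B) :
    n ≤ ⌈B⌉ := by
  have h1 : (1 : ℝ) ≤ n := by exact_mod_cast hn
  have h2 : (n : ℝ) ≤ B := by nlinarith [one_le_pi_sq]
  exact_mod_cast h2.trans (Int.le_ceil B)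

lemma P_finite {a : ℝ × ℝ × ℝ} (h1 : 0 < a.1) (h2 : 0 < a.2.1) (h3 : 0 < a.2.2) (lam : ℝ) :
    (P a lam).Finite := by
  refine (Set.finite_Icc ((1, 1, 1) : ℤ × ℤ × ℤ)
    (⌈lam * a.1 ^ 2⌉, ⌈lam * a.2.1 ^ 2⌉, ⌈lam * a.2.2 ^ 2⌉)).subset ?_
  rintro p ⟨⟨q1, q2, q3⟩, hp⟩
  obtain ⟨c1, c2, c3⟩ := coord_bound h1 h2 h3 hp
  exact ⟨⟨q1, q2, q3⟩, le_of_sq q1 c1, le_of_sq q2 c2, le_of_sq q3 c3⟩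

lemma mem_T {a : ℝ × ℝ × ℝ} (h1 : 0 < a.1) (h2 : 0 < a.2.1) (h3 : 0 < a.2.2) (k : ℕ)
    (lam : ℝ) : k ≤ cuboidCount a.1 a.2.1 a.2.2 lam ↔
    ∃ S : Finset (ℤ × ℤ × ℤ), S.card = k ∧ ∀ p ∈ S, Pos p ∧ f a p ≤ lam := by
  rw [count_eq]
  have hf := P_finite h1 h2 h3 lam
  rw [Set.ncard_eq_toFinset_card _ hf]
  constructor
  · intro h
    obtain ⟨S, hS, hc⟩ := Finset.exists_subset_card_eq h
    exact ⟨S, hc, fun p hp => by simpa [P] using hS hp⟩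
  · rintro ⟨S, hc, hS⟩
    rw [← hc]
    exact Finset.card_le_card fun p hp => by simpa [P] using hS p hp

lemma eig_le {a : ℝ × ℝ × ℝ} (h1 : 0 < a.1) (h2 : 0 < a.2.1) (h3 : 0 < a.2.2) {k : ℕ}
    (hk : 1 ≤ k) {lam : ℝ} (S : Finset (ℤ × ℤ × ℤ)) (hc : S.card = k)
    (hS : ∀ p ∈ S, Pos p ∧ f a p ≤ lam) : cuboidEig a.1 a.2.1 a.2.2 k ≤ lam := by
  refine csInf_le ⟨0, ?_⟩ ((mem_T h1 h2 h3 k lam).2 ⟨S, hc, hS⟩)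
  intro l hl
  obtain ⟨S, hc, hS⟩ := (mem_T h1 h2 h3 k l).1 hl
  obtain ⟨p, hp⟩ := Finset.card_pos.1 (by omega : 0 < S.card)
  exact (f_nonneg a p).trans (hS p hp).2

lemma eig_attained {a : ℝ × ℝ × ℝ} (h1 : 0 < a.1) (h2 : 0 < a.2.1) (h3 : 0 < a.2.2) {k : ℕ}
    (hk : 1 ≤ k) : ∃ S : Finset (ℤ × ℤ × ℤ), S.card = k ∧
      ∀ p ∈ S, Pos p ∧ f a p ≤ cuboidEig a.1 a.2.1 a.2.2 k := by
  classical
  -- some nonempty level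
  obtain ⟨S0, hc0, hS0⟩ : ∃ S : Finset (ℤ × ℤ × ℤ), S.card = k ∧ ∀ p ∈ S, Pos p := by
    refine ⟨(Finset.range k).image (fun n : ℕ => ((n : ℤ) + 1, 1, 1)), ?_, ?_⟩
    · rw [Finset.card_image_of_injective, Finset.card_range]
      intro m n h
      simpa using h
    · intro p hp
      obtain ⟨n, -, rfl⟩ := Finset.mem_image.1 hp
      refine ⟨?_, le_rfl, le_rfl⟩
      show (1 : ℤ) ≤ (n : ℤ) + 1
      omega
  have key : ∀ S : Finset (ℤ × ℤ × ℤ), S.card = k → ∃ q ∈ S, ∀ p ∈ S, f a p ≤ f a q :=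
    fun S hS => S.exists_max_image (f a) (Finset.card_pos.1 (by omega))
  obtain ⟨q0, hq0, hm0⟩ := key S0 hc0
  let F : Finset (ℤ × ℤ × ℤ) := (P_finite h1 h2 h3 (f a q0)).toFinset.filter
    (fun q => k ≤ cuboidCount a.1 a.2.1 a.2.2 (f a q))
  have hF : ∀ q, q ∈ F ↔ (Pos q ∧ f a q ≤ f a q0) ∧
      k ≤ cuboidCount a.1 a.2.1 a.2.2 (f a q) := by
    intro q; simp [F, P]
  have hq0F : q0 ∈ F := (hF q0).2 ⟨⟨hS0 q0 hq0, le_rfl⟩,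
    (mem_T h1 h2 h3 k _).2 ⟨S0, hc0, fun p hp => ⟨hS0 p hp, hm0 p hp⟩⟩⟩
  obtain ⟨q, hq, hmin⟩ := F.exists_min_image (f a) ⟨q0, hq0F⟩
  obtain ⟨S, hc, hS⟩ := (mem_T h1 h2 h3 k _).1 ((hF q).1 hq).2
  have hle : f a q ≤ cuboidEig a.1 a.2.1 a.2.2 k := by
    refine le_csInf ⟨f a q, ((hF q).1 hq).2⟩ ?_
    intro l hl
    obtain ⟨S', hc', hS'⟩ := (mem_T h1 h2 h3 k l).1 hl
    obtain ⟨r, hr, hmr⟩ := key S' hc'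
    refine le_trans ?_ (hS' r hr).2
    rcases le_total (f a r) (f a q0) with h | h
    · exact hmin r ((hF r).2 ⟨⟨(hS' r hr).1, h⟩,
        (mem_T h1 h2 h3 k _).2 ⟨S', hc', fun p hp => ⟨(hS' p hp).1, hmr p hp⟩⟩⟩)
    · exact (hmin q0 hq0F).trans h
  exact ⟨S, hc, fun p hp => ⟨(hS p hp).1, (hS p hp).2.trans hle⟩⟩

/-- The compact set of admissible cuboids. -/
def K (L : ℝ) : Set (ℝ × ℝ × ℝ) :=
  {a | 0 ≤ a.1 ∧ a.1 ≤ a.2.1 ∧ a.2.1 ≤ a.2.2 ∧ a.1 * a.2.1 * a.2.2 = 1 ∧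
    Real.pi ^ 2 ≤ L * a.1 ^ 2}

lemma K_pos {L : ℝ} {a : ℝ × ℝ × ℝ} (h : a ∈ K L) : 0 < a.1 ∧ 0 < a.2.1 ∧ 0 < a.2.2 := by
  obtain ⟨h0, h1, h2, h3, -⟩ := h
  have : a.1 ≠ 0 := by rintro h; simp [h] at h3
  have : 0 < a.1 := lt_of_le_of_ne h0 this.symm
  exact ⟨this, by linarith, by linarith⟩

lemma K_le {L : ℝ} (hL : 0 ≤ L) {a : ℝ × ℝ × ℝ} (h : a ∈ K L) : a.2.2 ≤ L := by
  obtain ⟨p1, p2, p3⟩ := K_pos h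
  obtain ⟨h0, h1, h2, h3, h4⟩ := h
  have e1 : a.1 ^ 2 * a.2.2 ≤ 1 := by
    rw [← h3, sq]; gcongr
  have e2 : a.2.2 ≤ L * a.1 ^ 2 * a.2.2 := by
    have := one_le_pi_sq
    nlinarith
  calc a.2.2 ≤ L * (a.1 ^ 2 * a.2.2) := by linarith
    _ ≤ L * 1 := by gcongr
    _ = L := mul_one L

lemma K_compact {L : ℝ} (hL : 0 ≤ L) : IsCompact (K L) := by
  refine (isCompact_Icc (a := ((0, 0, 0) : ℝ × ℝ × ℝ)) (b := (L, L, L))).of_isClosed_subset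
    ?_ ?_
  · have c1 : IsClosed {a : ℝ × ℝ × ℝ | 0 ≤ a.1} := isClosed_le (by fun_prop) (by fun_prop)
    have c2 : IsClosed {a : ℝ × ℝ × ℝ | a.1 ≤ a.2.1} :=
      isClosed_le (by fun_prop) (by fun_prop)
    have c3 : IsClosed {a : ℝ × ℝ × ℝ | a.2.1 ≤ a.2.2} :=
      isClosed_le (by fun_prop) (by fun_prop)
    have c4 : IsClosed {a : ℝ × ℝ × ℝ | a.1 * a.2.1 * a.2.2 = 1} :=
      isClosed_eq (by fun_prop) (by fun_prop)
    have c5 : IsClosed {a : ℝ × ℝ × ℝ | Real.pi ^ 2 ≤ L * a.1 ^ 2} :=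
      isClosed_le (by fun_prop) (by fun_prop)
    exact c1.inter (c2.inter (c3.inter (c4.inter c5)))
  · intro a ha
    have hl := K_le hL ha
    obtain ⟨p1, p2, p3⟩ := K_pos ha
    obtain ⟨h0, h1, h2, h3, h4⟩ := ha
    exact ⟨⟨p1.le, p2.le, p3.le⟩, by show a.1 ≤ L; linarith, by show a.2.1 ≤ L; linarith, hl⟩

lemma f_cont (L : ℝ) (p : ℤ × ℤ × ℤ) : ContinuousOn (fun a => f a p) (K L) := by
  unfold f
  refine ContinuousOn.mul continuousOn_const ?_
  refine ((ContinuousOn.div (by fun_prop) (by fun_prop) ?_).add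
    (ContinuousOn.div (by fun_prop) (by fun_prop) ?_)).add
    (ContinuousOn.div (by fun_prop) (by fun_prop) ?_)
  · intro a ha; have := (K_pos ha).1; positivity
  · intro a ha; have := (K_pos ha).2.1; positivity
  · intro a ha; have := (K_pos ha).2.2; positivity

/-- For each index set, a minimising cuboid in `K L`. -/
lemma exists_min_S {L : ℝ} (hL : 0 ≤ L) (hne : (K L).Nonempty) (S : Finset (ℤ × ℤ × ℤ))
    (hS : S.Nonempty) : ∃ m : ℝ, (∃ a ∈ K L, ∀ p ∈ S, f a p ≤ m) ∧
      ∀ b ∈ K L, ∀ l : ℝ, (∀ p ∈ S, f b p ≤ l) → m ≤ l := by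
  have hc : ContinuousOn (fun a => S.sup' hS (fun p => f a p)) (K L) :=
    ContinuousOn.finset_sup'_apply hS fun p _ => f_cont L p
  obtain ⟨a, ha, hmin⟩ := (K_compact hL).exists_isMinOn hne hc
  refine ⟨S.sup' hS (fun p => f a p), ⟨a, ha, fun p hp => Finset.le_sup' (fun p => f a p) hp⟩, ?_⟩
  intro b hb l hl
  exact (hmin hb).trans (Finset.sup'_le hS _ hl)

end CuboidAux

open CuboidAux in
/-- For every `k ≥ 1`, the infimum of `λ_k` over cuboids of unit measure is attained:
there is a minimising triple `0 < a₁* ≤ a₂* ≤ a₃*` with `a₁*·a₂*·a₃* = 1`. -/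
theorem exists_minimising_cuboid (k : ℕ) (hk : 1 ≤ k) :
    ∃ a₁ a₂ a₃ : ℝ, IsMinimiser k a₁ a₂ a₃ := by
  classical
  obtain ⟨S1, hc1, hS1⟩ := eig_attained (a := (1, 1, 1)) one_pos one_pos one_pos hk
  obtain ⟨L, hLdef⟩ : ∃ L, L = cuboidEig 1 1 1 k := ⟨_, rfl⟩
  simp only [← hLdef] at hS1
  -- first eigenvalue bound
  have low : ∀ b : ℝ × ℝ × ℝ, 0 < b.1 → 0 < b.2.1 → 0 < b.2.2 → ∀ l : ℝ,
      ∀ S : Finset (ℤ × ℤ × ℤ), S.card = k → (∀ p ∈ S, Pos p ∧ f b p ≤ l) →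
      Real.pi ^ 2 ≤ l * b.1 ^ 2 := by
    intro b b1 b2 b3 l S hc hS
    obtain ⟨p, hp⟩ := Finset.card_pos.1 (by omega : 0 < S.card)
    obtain ⟨hpos, hle⟩ := hS p hp
    have h := (coord_bound b1 b2 b3 hle).1
    have h1 : (1 : ℝ) ≤ p.1 := by exact_mod_cast hpos.1
    have h2 : (1 : ℝ) ≤ (p.1 : ℝ) ^ 2 := one_le_pow₀ h1
    exact (le_mul_of_one_le_right (sq_nonneg _) h2).trans h
  have h111 := low (1, 1, 1) one_pos one_pos one_pos L S1 hc1 hS1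
  have hK1 : ((1, 1, 1) : ℝ × ℝ × ℝ) ∈ K L :=
    ⟨zero_le_one, le_rfl, le_rfl, by norm_num, h111⟩
  have hL : 0 ≤ L := by
    have := one_le_pi_sq
    norm_num at h111
    linarith
  -- relevant index sets
  let box : Finset (ℤ × ℤ × ℤ) := Finset.Icc (1, 1, 1) (⌈L ^ 3⌉, ⌈L ^ 3⌉, ⌈L ^ 3⌉)
  have inbox : ∀ b ∈ K L, ∀ l ≤ L, ∀ p, Pos p → f b p ≤ l → p ∈ box := by
    intro b hb l hl p hp hfp
    obtain ⟨b1, b2, b3⟩ := K_pos hb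
    have hle := K_le hL hb
    obtain ⟨c1, c2, c3⟩ := coord_bound b1 b2 b3 (hfp.trans hl)
    have aux : ∀ x : ℝ, 0 < x → x ≤ L → L * x ^ 2 ≤ L ^ 3 := by
      intro x hx hxL
      calc L * x ^ 2 ≤ L * L ^ 2 := by gcongr
        _ = L ^ 3 := by ring
    have o1 := hb.2.1
    have o2 := hb.2.2.1
    exact Finset.mem_Icc.2 ⟨⟨hp.1, hp.2.1, hp.2.2⟩,
      le_of_sq hp.1 (c1.trans (aux _ b1 (by linarith))),
      le_of_sq hp.2.1 (c2.trans (aux _ b2 (by linarith))),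
      le_of_sq hp.2.2 (c3.trans (aux _ b3 hle))⟩
  have hex : ∀ S : Finset (ℤ × ℤ × ℤ), ∃ m : ℝ, S.card = k →
      (∃ a ∈ K L, ∀ p ∈ S, f a p ≤ m) ∧
      ∀ b ∈ K L, ∀ l : ℝ, (∀ p ∈ S, f b p ≤ l) → m ≤ l := by
    intro S
    by_cases hc : S.card = k
    · obtain ⟨m, hm⟩ := exists_min_S hL ⟨_, hK1⟩ S (Finset.card_pos.1 (by omega))
      exact ⟨m, fun _ => hm⟩
    · exact ⟨0, fun h => absurd h hc⟩
  choose m hm using hex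
  have hmem : ∀ b ∈ K L, ∀ l ≤ L, ∀ S : Finset (ℤ × ℤ × ℤ), S.card = k →
      (∀ p ∈ S, Pos p ∧ f b p ≤ l) → S ∈ box.powersetCard k := by
    intro b hb l hl S hc hS
    exact Finset.mem_powersetCard.2
      ⟨fun p hp => inbox b hb l hl p (hS p hp).1 (hS p hp).2, hc⟩
  have hS1mem := hmem _ hK1 L le_rfl S1 hc1 hS1
  obtain ⟨S, hS, hmin⟩ := (box.powersetCard k).exists_min_image m ⟨S1, hS1mem⟩
  obtain ⟨hSb, hSc⟩ := Finset.mem_powersetCard.1 hS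
  obtain ⟨a, ha, hfa⟩ := (hm S hSc).1
  obtain ⟨a1, a2, a3⟩ := K_pos ha
  have hle : cuboidEig a.1 a.2.1 a.2.2 k ≤ m S := by
    refine eig_le a1 a2 a3 hk S hSc fun p hp => ⟨?_, hfa p hp⟩
    obtain ⟨h1, h2, h3⟩ := (Finset.mem_Icc.1 (hSb hp)).1
    exact ⟨h1, h2, h3⟩
  have hmL : m S ≤ L :=
    (hmin S1 hS1mem).trans ((hm S1 hc1).2 _ hK1 L fun p hp => (hS1 p hp).2)
  refine ⟨a.1, a.2.1, a.2.2, a1, ha.2.1, ha.2.2.1, ha.2.2.2.1, ?_⟩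
  intro b₁ b₂ b₃ hb1 hb12 hb23 hprod
  refine hle.trans ?_
  have hb2 : 0 < b₂ := by linarith
  have hb3 : 0 < b₃ := by linarith
  rcases le_total L (cuboidEig b₁ b₂ b₃ k) with h | h
  · exact hmL.trans h
  obtain ⟨S', hc', hS'⟩ := eig_attained (a := (b₁, b₂, b₃)) hb1 hb2 hb3 hk
  have hb : ((b₁, b₂, b₃) : ℝ × ℝ × ℝ) ∈ K L :=
    ⟨hb1.le, hb12, hb23, hprod, low (b₁, b₂, b₃) hb1 hb2 hb3 L S' hc'
      fun p hp => ⟨(hS' p hp).1, (hS' p hp).2.trans h⟩⟩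
  exact (hmin S' (hmem _ hb _ h S' hc' hS')).trans
    ((hm S' hc').2 _ hb _ fun p hp => (hS' p hp).2)
end

section
/- Suppose β ∈ [0,2) and C > 0 form a sphere-remainder pair, θ ∈ [0,2) and D > 0 form a circle-remainder pair, and θ ≤ β. Then for any choice, for each k ≥ 1, of a minimiser (a₁,k*, a₂,k*, a₃,k*) for λ_k, one has a₁,k* → 1, a₂,k* → 1 and a₃,k* → 1 as k → ∞; i.e. any sequence of optimal cuboids of unit measure converges to the unit cube. -/
/-- `(β, C)` is a sphere-remainder pair: `β ∈ [0,2)`, `C > 0`, and the number of integer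
lattice points in the closed ball of radius `R` in `ℝ³` differs from `(4π/3)R³` by at
most `C(R^β + 1)` for all `R ≥ 0`. -/
noncomputable def SphereRemainderPair (β C : ℝ) : Prop :=
  0 ≤ β ∧ β < 2 ∧ 0 < C ∧ ∀ R : ℝ, 0 ≤ R →
    |(Nat.card {p : ℤ × ℤ × ℤ //
        (p.1 : ℝ) ^ 2 + (p.2.1 : ℝ) ^ 2 + (p.2.2 : ℝ) ^ 2 ≤ R ^ 2} : ℝ)
      - (4 * Real.pi / 3) * R ^ 3| ≤ C * (R ^ β + 1)

/-- `(θ, D)` is a circle-remainder pair: `θ ∈ [0,2)`, `D > 0`, and the number of integer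
lattice points in the closed disc of radius `R` in `ℝ²` differs from `πR²` by at most
`D(R^θ + 1)` for all `R ≥ 0`. -/
noncomputable def CircleRemainderPair (θ D : ℝ) : Prop :=
  0 ≤ θ ∧ θ < 2 ∧ 0 < D ∧ ∀ R : ℝ, 0 ≤ R →
    |(Nat.card {p : ℤ × ℤ //
        (p.1 : ℝ) ^ 2 + (p.2 : ℝ) ^ 2 ≤ R ^ 2} : ℝ)
      - Real.pi * R ^ 2| ≤ D * (R ^ θ + 1)


section
open Finset

lemma sum_mod (q : ℕ) (hq : 0 < q) (p k : ℤ) (hc : IsCoprime p (q:ℤ)) :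
    ∑ j ∈ range q, ((k + j * p) % (q:ℤ)) = ∑ j ∈ range q, (j:ℤ) := by
  have hq' : (0:ℤ) < q := by exact_mod_cast hq
  have hmaps : ∀ j ∈ range q, ((k + j * p) % (q:ℤ)).toNat ∈ range q := by
    intro j _
    rw [mem_range]
    have h1 := Int.emod_nonneg (k + j * p) hq'.ne'
    have h2 := Int.emod_lt_of_pos (k + j * p) hq'
    omega
  have hinj : Set.InjOn (fun j : ℕ => ((k + j * p) % (q:ℤ)).toNat) (range q : Set ℕ) := by
    intro i hi j hj hij
    simp only [coe_range, Set.mem_Iio] at hi hj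
    have h1 := Int.emod_nonneg (k + i * p) hq'.ne'
    have h2 := Int.emod_nonneg (k + j * p) hq'.ne'
    have h3 : (k + i * p) % (q:ℤ) = (k + j * p) % (q:ℤ) := by
      have hij' : ((k + i * p) % (q:ℤ)).toNat = ((k + j * p) % (q:ℤ)).toNat := hij
      omega
    have h4 : (q:ℤ) ∣ (k + j * p) - (k + i * p) := Int.ModEq.dvd h3
    have h5 : (q:ℤ) ∣ p * ((j:ℤ) - i) := by
      convert h4 using 1; ring
    have h6 : (q:ℤ) ∣ (j:ℤ) - i := hc.symm.dvd_of_dvd_mul_left h5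
    have h7 := Int.eq_zero_of_abs_lt_dvd h6 (by rw [abs_lt]; constructor <;> omega)
    omega
  refine Finset.sum_nbij (fun j : ℕ => ((k + j * p) % (q:ℤ)).toNat) hmaps hinj ?_ ?_
  · exact Finset.surjOn_of_injOn_of_card_le _ hmaps hinj le_rfl
  · intro j _
    have h1 := Int.emod_nonneg (k + j * p) hq'.ne'
    omega

lemma block_floor (q : ℕ) (hq : 0 < q) (p : ℤ) (hc : IsCoprime p (q:ℤ)) (α : ℝ) :
    ∑ j ∈ range q, (⌊α + j * ((p:ℝ) / q)⌋ : ℝ) ≤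
      ∑ j ∈ range q, (α + j * ((p:ℝ) / q)) - ((q:ℝ) - 1) / 2 := by
  have hq' : (0:ℝ) < q := by exact_mod_cast hq
  have hq0 : (q:ℝ) ≠ 0 := hq'.ne'
  have key : ∀ j ∈ range q, (⌊α + j * ((p:ℝ) / q)⌋ : ℝ) ≤
      (α + j * ((p:ℝ) / q)) - (((⌊(q:ℝ) * α⌋ + j * p) % (q:ℤ) : ℤ) : ℝ) / q := by
    intro j _
    have e1 : α + j * ((p:ℝ) / q) = ((q:ℝ) * α + ((j * p : ℤ):ℝ)) / q := by
      push_cast; field_simp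
    have e2 : ⌊α + j * ((p:ℝ) / q)⌋ = (⌊(q:ℝ) * α⌋ + j * p) / (q:ℤ) := by
      rw [e1, Int.floor_div_natCast, Int.floor_add_intCast]
    rw [e2]
    set m := ⌊(q:ℝ) * α⌋ + j * p with hm
    have e3 := Int.emod_add_mul_ediv m (q:ℤ)
    have e4 : ((m % (q:ℤ) : ℤ) : ℝ) + q * ((m / (q:ℤ) : ℤ) : ℝ) = (m : ℝ) := by
      exact_mod_cast e3
    have e5 : (m:ℝ) ≤ q * α + j * p := by
      rw [hm]; push_cast
      have := Int.floor_le ((q:ℝ) * α)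
      linarith
    have e6 : ((m / (q:ℤ) : ℤ) : ℝ) = ((m:ℝ) - ((m % (q:ℤ) : ℤ) : ℝ)) / q := by
      field_simp; linarith
    rw [e6, e1, ← sub_div]
    apply div_le_div_of_nonneg_right _ hq'.le
    push_cast; linarith
  refine (Finset.sum_le_sum key).trans ?_
  rw [Finset.sum_sub_distrib, ← Finset.sum_div, ← Int.cast_sum, sum_mod q hq p _ hc]
  have : (∑ j ∈ range q, (j:ℤ) : ℤ) * 2 = q * ((q:ℤ) - 1) := by
    have := Finset.sum_range_id_mul_two q
    have h2 : ((∑ j ∈ range q, j : ℕ) : ℤ) * 2 = ((q * (q - 1) : ℕ) : ℤ) := by exact_mod_cast this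
    rw [Nat.cast_mul, Nat.cast_sub hq] at h2
    push_cast at h2
    exact h2
  have h3 : ((∑ j ∈ range q, (j:ℤ) : ℤ) : ℝ) * 2 = q * ((q:ℝ) - 1) := by exact_mod_cast this
  have : ((∑ j ∈ range q, (j:ℤ) : ℤ) : ℝ) / q = ((q:ℝ) - 1) / 2 := by
    field_simp; linarith
  rw [this]


/-- slopes decrease by at most `h` : lower bound. -/
lemma slope_lower (f : ℕ → ℝ) (x : ℕ) (h : ℝ) (m : ℕ)
    (hd : ∀ i, x ≤ i → i < x + m → (f (i+1) - f i) - (f (i+2) - f (i+1)) ≤ h) :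
    (f (x+1) - f x) - m * h ≤ f (x + m + 1) - f (x + m) := by
  induction m with
  | zero => simp
  | succ m ih =>
    have h1 := ih (fun i hi hi' => hd i hi (by omega))
    have h2 := hd (x + m) (by omega) (by omega)
    have e : x + (m + 1) = x + m + 1 := by ring
    rw [e]
    push_cast
    have e2 : f (x + m + 1 + 1) = f (x + m + 2) := rfl
    rw [e2]
    linarith

lemma slope_upper (f : ℕ → ℝ) (x : ℕ) (h : ℝ) (m : ℕ)
    (hd : ∀ i, x ≤ i → i < x + m → h ≤ (f (i+1) - f i) - (f (i+2) - f (i+1))) :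
    f (x + m + 1) - f (x + m) ≤ (f (x+1) - f x) - m * h := by
  induction m with
  | zero => simp
  | succ m ih =>
    have h1 := ih (fun i hi hi' => hd i hi (by omega))
    have h2 := hd (x + m) (by omega) (by omega)
    have e : x + (m + 1) = x + m + 1 := by ring
    rw [e]
    push_cast
    have e2 : f (x + m + 1 + 1) = f (x + m + 2) := rfl
    rw [e2]
    linarith

lemma taylor (f : ℕ → ℝ) (x : ℕ) (h : ℝ) (hh : 0 ≤ h) (m : ℕ)
    (hd : ∀ i, x ≤ i → i < x + m → 0 ≤ (f (i+1) - f i) - (f (i+2) - f (i+1)) ∧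
      (f (i+1) - f i) - (f (i+2) - f (i+1)) ≤ h) :
    f (x + m) ≤ f x + m * (f (x+1) - f x) ∧
    f x + m * (f (x+1) - f x) - m ^ 2 * h ≤ f (x + m) := by
  induction m with
  | zero => simp
  | succ m ih =>
    obtain ⟨h1, h2⟩ := ih (fun i hi hi' => hd i hi (by omega))
    have h3 := slope_lower f x h m (fun i hi hi' => (hd i hi (by omega)).2)
    have h4 := slope_upper f x 0 m (fun i hi hi' => (hd i hi (by omega)).1)
    have e : x + (m + 1) = x + m + 1 := by ring
    rw [e]
    push_cast
    have : 0 ≤ (m:ℝ) * h := by positivity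
    constructor
    · linarith
    · nlinarith

lemma block_est (f : ℕ → ℝ) (x T : ℕ) (h : ℝ) (hh : 0 ≤ h) (ρ : ℚ)
    (hT : ρ.den ≤ T) (hTh : (T:ℝ)^3 * h ≤ 1)
    (hd : ∀ i, x ≤ i → i < x + T → 0 ≤ (f (i+1) - f i) - (f (i+2) - f (i+1)) ∧
      (f (i+1) - f i) - (f (i+2) - f (i+1)) ≤ h)
    (hρ : |(f (x+1) - f x) - (ρ:ℝ)| ≤ 1 / (((T:ℝ) + 1) * ρ.den)) :
    ∑ j ∈ range ρ.den, (⌊f (x + j)⌋ : ℝ) ≤ ∑ j ∈ range ρ.den, f (x + j)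
      - (ρ.den : ℝ) / 2 + 5 := by
  set q := ρ.den with hq
  have hq0 : 0 < q := ρ.den_pos
  have hq' : (0:ℝ) < q := by exact_mod_cast hq0
  have hTR : (q:ℝ) ≤ T := by exact_mod_cast hT
  have hT0 : (0:ℝ) < T := hq'.trans_le hTR
  have hρe : (ρ:ℝ) = (ρ.num : ℝ) / q := by
    rw [hq]; exact_mod_cast (Rat.num_div_den ρ).symm
  have hcop : IsCoprime ρ.num (q:ℤ) := by
    have := ρ.reduced
    rw [Int.isCoprime_iff_gcd_eq_one]
    simpa [Nat.Coprime, Int.gcd] using this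
  have hclose : ∀ j ∈ range q, |f (x + j) - (f x + j * ((ρ.num : ℝ) / q))| ≤ 2 / q := by
    intro j hj
    rw [mem_range] at hj
    have hjq : (j:ℝ) ≤ q := by exact_mod_cast hj.le
    have hj0 : (0:ℝ) ≤ j := Nat.cast_nonneg j
    obtain ⟨t1, t2⟩ := taylor f x h hh j (fun i hi hi' => hd i hi (by omega))
    have b1 : (j:ℝ)^2 * h ≤ 1 / q := by
      rw [le_div_iff₀ hq']
      have hj2 : (j:ℝ)^2 ≤ T^2 := pow_le_pow_left₀ hj0 (hjq.trans hTR) 2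
      calc (j:ℝ)^2 * h * q ≤ T^2 * h * T := by gcongr
        _ = T^3 * h := by ring
        _ ≤ 1 := hTh
    have b2 : |(j:ℝ) * ((f (x+1) - f x) - (ρ:ℝ))| ≤ 1 / q := by
      rw [abs_mul, abs_of_nonneg hj0]
      calc (j:ℝ) * |(f (x+1) - f x) - (ρ:ℝ)| ≤ q * (1 / (((T:ℝ) + 1) * q)) := by gcongr
        _ = 1 / ((T:ℝ) + 1) := by field_simp
        _ ≤ 1 / q := by
          apply one_div_le_one_div_of_le hq'; linarith
    rw [← hρe]
    have e : (2:ℝ)/q = 1/q + 1/q := by ring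
    rw [e]
    rw [abs_le] at b2 ⊢
    constructor <;> nlinarith
  have s1 : ∑ j ∈ range q, (⌊f (x + j)⌋ : ℝ) ≤
      ∑ j ∈ range q, (⌊(f x + 2 / q) + j * ((ρ.num : ℝ) / q)⌋ : ℝ) := by
    apply Finset.sum_le_sum
    intro j hj
    have := (abs_le.1 (hclose j hj)).2
    have hfl : ⌊f (x + j)⌋ ≤ ⌊(f x + 2 / q) + j * ((ρ.num : ℝ) / q)⌋ :=
      Int.floor_mono (by linarith)
    exact Int.cast_le.2 hfl
  have s2 := block_floor q hq0 ρ.num hcop (f x + 2 / q)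
  have s3 : ∑ j ∈ range q, ((f x + 2 / q) + j * ((ρ.num : ℝ) / q)) ≤
      ∑ j ∈ range q, (f (x + j) + 4 / q) := by
    apply Finset.sum_le_sum
    intro j hj
    have := (abs_le.1 (hclose j hj)).1
    have e : (4:ℝ)/q = 2/q + 2/q := by ring
    linarith
  have s4 : ∑ j ∈ range q, (f (x + j) + 4 / q) = ∑ j ∈ range q, f (x + j) + 4 := by
    rw [Finset.sum_add_distrib]
    simp
    field_simp
  linarith

/-- bad slope -/
def BadSlope (Q T : ℕ) (d : ℝ) : Prop := ∃ ρ : ℚ, ρ.den < Q ∧ |d - (ρ:ℝ)| ≤ 1 / ((T:ℝ) + 1)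

open Classical in
lemma block_induct (f : ℕ → ℝ) (n Q T : ℕ) (h : ℝ) (hh : 0 ≤ h) (hQ : 0 < Q) (hQT : Q ≤ T)
    (hTh : (T:ℝ)^3 * h ≤ 1)
    (hd : ∀ i, i < n → 0 ≤ (f (i+1) - f i) - (f (i+2) - f (i+1)) ∧
      (f (i+1) - f i) - (f (i+2) - f (i+1)) ≤ h) (m : ℕ) :
    ∀ x, x + m = n →
    ∑ i ∈ Finset.Ico x n, (⌊f i⌋ : ℝ) ≤ ∑ i ∈ Finset.Ico x n, f i - (m:ℝ) / 2 + (5 / Q) * m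
      + #{i ∈ Finset.Ico x n | BadSlope Q T (f (i+1) - f i)} + T := by
  have hQ' : (0:ℝ) < Q := by exact_mod_cast hQ
  induction m using Nat.strong_induction_on with
  | _ m ih =>
  intro x hx
  have triv : ∀ s : Finset ℕ, ∑ i ∈ s, (⌊f i⌋ : ℝ) ≤ ∑ i ∈ s, f i :=
    fun s => Finset.sum_le_sum (fun i _ => Int.floor_le _)
  by_cases hm : m ≤ T
  · have h1 := triv (Finset.Ico x n)
    have h2 : (m:ℝ) ≤ T := by exact_mod_cast hm
    have h3 : (0:ℝ) ≤ (5 / Q) * m := by positivity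
    have h4 : (0:ℝ) ≤ (m:ℝ) := by positivity
    have h5 : (0:ℝ) ≤ (#{i ∈ Finset.Ico x n | BadSlope Q T (f (i+1) - f i)} : ℝ) := by positivity
    linarith
  · push Not at hm
    by_cases hb : BadSlope Q T (f (x+1) - f x)
    · have h1 := ih (m-1) (by omega) (x+1) (by omega)
      have hlt : x < n := by omega
      rw [← Finset.insert_Ico_add_one_left_eq_Ico hlt, Finset.filter_insert, if_pos hb,
        Finset.sum_insert (by simp), Finset.sum_insert (by simp),
        Finset.card_insert_of_notMem (by simp)]
      have h2 : ((m - 1 : ℕ) : ℝ) = m - 1 := by rw [Nat.cast_sub (by omega)]; simp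
      rw [h2] at h1
      have h3 := Int.floor_le (f x)
      have h4 : (0:ℝ) ≤ 5 / Q := by positivity
      push_cast
      linarith
    · obtain ⟨ρ, hρ1, hρ2⟩ := Real.exists_rat_abs_sub_le_and_den_le (f (x+1) - f x) (n := T) (by omega)
      have hden : (1:ℝ) ≤ ρ.den := by exact_mod_cast ρ.den_pos
      have hTn : (0:ℝ) ≤ T := Nat.cast_nonneg T
      have hQq : Q ≤ ρ.den := by
        by_contra hlt
        push Not at hlt
        exact hb ⟨ρ, hlt, hρ1.trans (by
          apply one_div_le_one_div_of_le (by positivity); nlinarith)⟩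
      have h0 := block_est f x T h hh ρ hρ2 hTh (fun i hi hi' => hd i (by omega)) hρ1
      have hp := ρ.den_pos
      have h1 := ih (m - ρ.den) (by omega) (x + ρ.den) (by omega)
      rw [Nat.cast_sub (by omega)] at h1
      have split : ∀ g : ℕ → ℝ, ∑ i ∈ Finset.Ico x n, g i =
          ∑ j ∈ range ρ.den, g (x + j) + ∑ i ∈ Finset.Ico (x + ρ.den) n, g i := by
        intro g
        rw [← Finset.sum_Ico_consecutive g (show x ≤ x + ρ.den by omega) (show x + ρ.den ≤ n by omega),
          Finset.sum_Ico_eq_sum_range]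
        simp
      rw [split, split]
      have hcard : (#{i ∈ Finset.Ico (x + ρ.den) n | BadSlope Q T (f (i+1) - f i)} : ℝ) ≤
          #{i ∈ Finset.Ico x n | BadSlope Q T (f (i+1) - f i)} := by
        exact_mod_cast Finset.card_le_card (Finset.filter_subset_filter _
          (Finset.Ico_subset_Ico_left (by omega)))
      have h5 : 5 ≤ (5 / (Q:ℝ)) * ρ.den := by
        have : (Q:ℝ) ≤ ρ.den := by exact_mod_cast hQq
        rw [div_mul_eq_mul_div, le_div_iff₀ hQ']; linarith
      rw [mul_sub] at h1
      linarith

open Classical in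
lemma count_near (d : ℕ → ℝ) (n : ℕ) (h v w : ℝ) (hh : 0 < h) (hw : 0 ≤ w)
    (hd : ∀ x m, x + m < n → d (x + m) ≤ d x - m * h) :
    (#{i ∈ range n | |d i - v| ≤ w} : ℝ) ≤ 2 * w / h + 1 := by
  set X := ({i ∈ range n | |d i - v| ≤ w} : Finset ℕ) with hX
  rcases X.eq_empty_or_nonempty with he | hne
  · rw [he]; simp; positivity
  · have hu := X.min'_mem hne
    have hv := X.max'_mem hne
    set a := X.min' hne
    set b := X.max' hne
    have hab : a ≤ b := X.min'_le b hv
    have hsub : X ⊆ Finset.Icc a b := fun y hy =>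
      Finset.mem_Icc.2 ⟨X.min'_le y hy, X.le_max' y hy⟩
    have hc := Finset.card_le_card hsub
    rw [Nat.card_Icc] at hc
    rw [hX, Finset.mem_filter, mem_range] at hu hv
    have h1 := hd a (b - a) (by omega)
    rw [Nat.add_sub_cancel' hab, Nat.cast_sub hab] at h1
    have h2 := (abs_le.1 hu.2).2
    have h3 := (abs_le.1 hv.2).1
    have h4 : ((b:ℝ) - a) ≤ 2 * w / h := by
      rw [le_div_iff₀ hh]; linarith
    have h5 : (#X : ℝ) ≤ (b:ℝ) + 1 - a := by
      have : #X + a ≤ b + 1 := by omega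
      have : (#X : ℝ) + a ≤ b + 1 := by exact_mod_cast this
      linarith
    linarith

open Classical in
lemma count_bad (d : ℕ → ℝ) (n Q T N : ℕ) (h S : ℝ) (hh : 0 < h)
    (hS : ∀ i < n, |d i| ≤ S) (hN : Q * (S + 1) ≤ N)
    (hd : ∀ x m, x + m < n → d (x + m) ≤ d x - m * h) :
    (#{i ∈ range n | BadSlope Q T (d i)} : ℝ) ≤
      ((2 * N + 1) * Q) * (2 * (1 / ((T:ℝ) + 1)) / h + 1) := by
  set P : Finset (ℤ × ℕ) := Finset.Icc (-(N:ℤ)) N ×ˢ range Q with hP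
  have hsub : ({i ∈ range n | BadSlope Q T (d i)} : Finset ℕ) ⊆
      P.biUnion (fun pq => {i ∈ range n | |d i - (pq.1:ℝ) / pq.2| ≤ 1 / ((T:ℝ) + 1)}) := by
    intro i hi
    rw [Finset.mem_filter, mem_range] at hi
    obtain ⟨hin, ρ, hρ1, hρ2⟩ := hi
    have hρe : (ρ:ℝ) = (ρ.num : ℝ) / ρ.den := by
      exact_mod_cast (Rat.num_div_den ρ).symm
    rw [Finset.mem_biUnion]
    refine ⟨(ρ.num, ρ.den), ?_, ?_⟩
    · rw [hP, Finset.mem_product, Finset.mem_Icc, mem_range, ← abs_le]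
      refine ⟨?_, hρ1⟩
      have hden : (0:ℝ) < ρ.den := by exact_mod_cast ρ.den_pos
      have hρQ : (ρ.den:ℝ) ≤ Q := by exact_mod_cast hρ1.le
      have h1 : |(ρ:ℝ)| ≤ S + 1 := by
        have t1 : 1 / ((T:ℝ) + 1) ≤ 1 := by
          rw [div_le_one (by positivity)]; linarith [(Nat.cast_nonneg T : (0:ℝ) ≤ T)]
        have t2 := hS i hin
        have t3 : |(ρ:ℝ)| ≤ |d i| + |d i - ρ| := by
          have := abs_sub (d i) (d i - ρ)
          simpa using this
        linarith
      have h2 : |(ρ.num:ℝ)| = |(ρ:ℝ)| * ρ.den := by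
        rw [hρe, abs_div, abs_of_pos hden]; field_simp
      have h3 : |(ρ.num:ℝ)| ≤ N := by
        rw [h2]
        have := abs_nonneg (ρ:ℝ)
        have hS1 : 0 ≤ S + 1 := this.trans h1
        calc _ ≤ (S+1) * Q := by gcongr
          _ ≤ N := by linarith
      exact_mod_cast h3
    · rw [Finset.mem_filter, mem_range]
      simp only
      rw [← hρe]
      exact ⟨hin, hρ2⟩
  have h1 := Finset.card_le_card hsub
  have h2 : (#(P.biUnion (fun pq => {i ∈ range n | |d i - (pq.1:ℝ) / pq.2| ≤ 1 / ((T:ℝ) + 1)})) : ℝ)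
      ≤ ∑ pq ∈ P, (2 * (1 / ((T:ℝ) + 1)) / h + 1) := by
    refine le_trans (Nat.cast_le.2 Finset.card_biUnion_le) ?_
    rw [Nat.cast_sum]
    exact Finset.sum_le_sum (fun pq _ => count_near d n h _ _ hh (by positivity) hd)
  have h3 : (#P : ℝ) = (2 * N + 1) * Q := by
    rw [hP, Finset.card_product, Int.card_Icc, card_range]
    have : ((N:ℤ) + 1 - -(N:ℤ)).toNat = 2 * N + 1 := by omega
    rw [this]; push_cast; ring
  rw [Finset.sum_const, nsmul_eq_mul, h3] at h2
  exact le_trans (by exact_mod_cast h1) h2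

lemma key_floor (c C S ε : ℝ) (hc : 0 < c) (hC : 0 < C) (hS : 0 < S) (hε : 0 < ε) :
    ∃ R0 : ℝ, 0 < R0 ∧ ∀ R, R0 ≤ R → ∀ n : ℕ, (n:ℝ) ≤ R → ∀ f : ℕ → ℝ,
      (∀ i < n, c / R ≤ (f (i+1) - f i) - (f (i+2) - f (i+1)) ∧
        (f (i+1) - f i) - (f (i+2) - f (i+1)) ≤ C / R) →
      (∀ i < n, |f (i+1) - f i| ≤ S) →
      ∑ i ∈ range n, (⌊f i⌋ : ℝ) ≤ ∑ i ∈ range n, f i - (n:ℝ) / 2 + ε * R := by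
  classical
  obtain ⟨Q, hQ⟩ := exists_nat_gt (20 / ε)
  have hQ0 : (0:ℝ) < Q := lt_trans (by positivity) hQ
  obtain ⟨N, hN⟩ := exists_nat_ge (Q * (S + 1))
  set W : ℝ := (2 * N + 1) * Q with hW
  have hW0 : 0 < W := by positivity
  obtain ⟨T', hT'⟩ := exists_nat_gt (8 * W / (c * ε))
  set T := max T' Q with hTdef
  have hT : 8 * W / (c * ε) < T := lt_of_lt_of_le hT' (by rw [hTdef]; exact_mod_cast le_max_left _ _)
  have hT0 : (0:ℝ) < T := lt_trans (by positivity) hT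
  refine ⟨T^3 * C + 4 * W / ε + 4 * T / ε, by positivity, ?_⟩
  intro R hR n hn f hf hs
  have p1 : 0 < (T:ℝ)^3 * C := by positivity
  have p2 : 0 < 4 * W / ε := by positivity
  have p3 : 0 < 4 * T / ε := by positivity
  have hR0 : 0 < R := by linarith
  have hQN : 0 < Q := by exact_mod_cast hQ0
  have h1 := block_induct f n Q T (C / R) (by positivity) hQN (le_max_right _ _)
    (by rw [← mul_div_assoc, div_le_one hR0]; linarith)
    (fun i hi => ⟨le_trans (by positivity) (hf i hi).1, (hf i hi).2⟩) n 0 (by simp)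
  have h2 := count_bad (fun i => f (i+1) - f i) n Q T N (c / R) S (by positivity) hs hN
    (fun x m hxm => slope_upper f x (c/R) m (fun i _ hi' => (hf i (by omega)).1))
  rw [← hW] at h2
  simp only [← Finset.range_eq_Ico] at h1
  have e1 : (5 / (Q:ℝ)) * n ≤ ε / 4 * R := by
    have : 5 / (Q:ℝ) ≤ ε / 4 := by
      rw [div_lt_iff₀ hε] at hQ
      rw [div_le_iff₀ hQ0]; linarith
    gcongr
  have e2 : W * (2 * (1 / ((T:ℝ) + 1)) / (c / R) + 1) ≤ ε / 4 * R + ε / 4 * R := by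
    rw [mul_add]
    have a1 : W * 1 ≤ ε / 4 * R := by
      have : 4 * W / ε ≤ R := by linarith
      rw [div_le_iff₀ hε] at this; linarith
    have a2 : W * (2 * (1 / ((T:ℝ) + 1)) / (c / R)) ≤ ε / 4 * R := by
      have e : W * (2 * (1 / ((T:ℝ) + 1)) / (c / R)) = (2 * W / (c * (T+1))) * R := by
        field_simp
      rw [e]
      have : 2 * W / (c * (T+1)) ≤ ε / 4 := by
        rw [div_lt_iff₀ (by positivity)] at hT
        rw [div_le_iff₀ (by positivity)]
        nlinarith [mul_pos hc hε]
      gcongr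
    linarith
  have e3 : (T:ℝ) ≤ ε / 4 * R := by
    have : 4 * T / ε ≤ R := by linarith
    rw [div_le_iff₀ hε] at this; linarith
  linarith


/-- the circular arc -/
noncomputable def arc (A x : ℝ) : ℝ := √(A ^ 2 - x ^ 2)

lemma arc_nonneg (A x : ℝ) : 0 ≤ arc A x := Real.sqrt_nonneg _

lemma arc_cont (A : ℝ) : Continuous (arc A) := by unfold arc; fun_prop

lemma arc_int (A u v : ℝ) : IntervalIntegrable (arc A) MeasureTheory.volume u v :=
  (arc_cont A).intervalIntegrable _ _

lemma arc_anti (A : ℝ) : AntitoneOn (arc A) (Set.Ici 0) := by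
  intro x hx y _ hxy
  unfold arc
  apply Real.sqrt_le_sqrt
  have := pow_le_pow_left₀ hx hxy 2
  linarith

lemma arc_integral (A : ℝ) (hA : 0 ≤ A) : ∫ x in (0:ℝ)..A, arc A x = Real.pi * A ^ 2 / 4 := by
  rcases hA.eq_or_lt with rfl | hA
  · simp
  have h1 : ∫ x in (0:ℝ)..1, √(1 - x ^ 2) = Real.pi / 4 := by
    have hc : Continuous (fun x : ℝ => √(1 - x ^ 2)) := by fun_prop
    have h := integral_sqrt_one_sub_sq
    rw [← intervalIntegral.integral_add_adjacent_intervals (b := 0)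
      (hc.intervalIntegrable _ _) (hc.intervalIntegrable _ _)] at h
    have h2 : ∫ x in (-1:ℝ)..0, √(1 - x ^ 2) = ∫ x in (0:ℝ)..1, √(1 - x ^ 2) := by
      have := intervalIntegral.integral_comp_neg (a := 0) (b := 1) (fun x : ℝ => √(1 - x ^ 2))
      simp only [neg_sq, neg_zero] at this
      exact this.symm
    linarith
  have h2 : ∀ x : ℝ, arc A x = A * √(1 - (x / A) ^ 2) := by
    intro x
    unfold arc
    have : A ^ 2 - x ^ 2 = A ^ 2 * (1 - (x / A) ^ 2) := by field_simp
    rw [this, Real.sqrt_mul (by positivity), Real.sqrt_sq hA.le]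
  simp only [h2]
  rw [intervalIntegral.integral_const_mul,
    intervalIntegral.integral_comp_div (fun x : ℝ => √(1 - x ^ 2)) hA.ne']
  simp only [zero_div, div_self hA.ne', h1, smul_eq_mul]
  ring

lemma arc_sum_le (A : ℝ) (hA : 0 ≤ A) :
    ∑ i ∈ range ⌊A⌋₊, arc A ((i:ℝ) + 1) ≤ Real.pi * A ^ 2 / 4 := by
  have h := AntitoneOn.sum_le_integral (x₀ := 0) (a := ⌊A⌋₊) (f := arc A)
    ((arc_anti A).mono (fun x hx => hx.1))
  simp only [zero_add, Nat.cast_add, Nat.cast_one] at h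
  refine h.trans ?_
  rw [← arc_integral A hA, ← intervalIntegral.integral_add_adjacent_intervals
    (arc_int A 0 ⌊A⌋₊) (arc_int A ⌊A⌋₊ A)]
  have : 0 ≤ ∫ x in (⌊A⌋₊:ℝ)..A, arc A x :=
    intervalIntegral.integral_nonneg (Nat.floor_le hA) (fun x _ => arc_nonneg A x)
  linarith

lemma arc_sum_ge (A : ℝ) (hA : 0 ≤ A) :
    Real.pi * A ^ 2 / 4 - A ≤ ∑ i ∈ range ⌊A⌋₊, arc A ((i:ℝ) + 1) := by
  have h := AntitoneOn.integral_le_sum (x₀ := 0) (a := ⌊A⌋₊ + 1) (f := arc A)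
    ((arc_anti A).mono (fun x hx => hx.1))
  simp only [zero_add, Nat.cast_add, Nat.cast_one] at h
  rw [Finset.sum_range_succ'] at h
  have h0 : arc A ((0:ℕ):ℝ) = A := by unfold arc; simp [Real.sqrt_sq hA]
  rw [h0] at h
  rw [← intervalIntegral.integral_add_adjacent_intervals
    (arc_int A 0 A) (arc_int A A (⌊A⌋₊ + 1)), arc_integral A hA] at h
  have : 0 ≤ ∫ x in A..((⌊A⌋₊:ℝ) + 1), arc A x :=
    intervalIntegral.integral_nonneg (Nat.lt_floor_add_one A).le (fun x _ => arc_nonneg A x)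
  push_cast at h
  linarith

lemma arc_sq (A x : ℝ) (hx : 0 ≤ x) (hxA : x ≤ A) : arc A x ^ 2 = A ^ 2 - x ^ 2 := by
  unfold arc
  rw [Real.sq_sqrt]
  have := pow_le_pow_left₀ hx hxA 2
  linarith

lemma arc_trap (A p : ℝ) (hp : 0 ≤ p) (hpA : p + 1 ≤ A) :
    (arc A p + arc A (p + 1)) / 2 ≤ ∫ x in p..(p + 1), arc A x := by
  have hu := arc_sq A p hp (by linarith)
  have hv := arc_sq A (p+1) (by linarith) hpA
  set u := arc A p
  set v := arc A (p + 1)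
  have hlin : ∫ x in p..(p + 1), (u + (x - p) * (v - u)) = (u + v) / 2 := by
    rw [intervalIntegral.integral_add (by simp) (by apply Continuous.intervalIntegrable; fun_prop),
      intervalIntegral.integral_mul_const, intervalIntegral.integral_sub (by simp) (by simp)]
    simp
    ring
  rw [← hlin]
  apply intervalIntegral.integral_mono_on (by linarith)
  · apply Continuous.intervalIntegrable; fun_prop
  · exact arc_int A _ _
  · intro x hx
    obtain ⟨t, rfl⟩ : ∃ t, x = p + t := ⟨x - p, by ring⟩
    have ht0 : 0 ≤ t := by linarith [hx.1]
    have ht1 : t ≤ 1 := by linarith [hx.2]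
    apply Real.le_sqrt_of_sq_le
    have h1 : 0 ≤ t * (1 - t) * ((u - v)^2 + 1) := by
      have : 0 ≤ 1 - t := by linarith
      positivity
    have e : (u + (p + t - p) * (v - u))^2 + (p + t)^2 =
       (1 - t) * (u^2 + p^2) + t * (v^2 + (p+1)^2) - t * (1 - t) * ((u - v)^2 + 1) := by ring
    rw [hu, hv] at e
    linarith

lemma arc_sum_le' (A : ℝ) (hA : 0 ≤ A) :
    ∑ i ∈ range ⌊A⌋₊, arc A ((i:ℝ) + 1) ≤ Real.pi * A ^ 2 / 4 - A / 2 + √(2 * A) / 2 := by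
  have key : ∀ n : ℕ, (n:ℝ) ≤ A → ∑ i ∈ range n, arc A ((i:ℝ) + 1) ≤
      (∫ x in (0:ℝ)..n, arc A x) - arc A 0 / 2 + arc A n / 2 := by
    intro n
    induction n with
    | zero => intro _; simp
    | succ n ih =>
      intro hn
      push_cast at hn
      have h1 := ih (by linarith)
      have h2 := arc_trap A n (by positivity) hn
      rw [Finset.sum_range_succ, Nat.cast_add, Nat.cast_one,
        ← intervalIntegral.integral_add_adjacent_intervals (arc_int A 0 n) (arc_int A n (n+1))]
      linarith
  have h := key ⌊A⌋₊ (Nat.floor_le hA)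
  have h0 : arc A 0 = A := by unfold arc; simp [Real.sqrt_sq hA]
  have h1 : arc A ⌊A⌋₊ ≤ √(2 * A) := by
    unfold arc
    apply Real.sqrt_le_sqrt
    have t1 := Nat.floor_le hA
    have t2 := Nat.lt_floor_add_one A
    nlinarith [(Nat.cast_nonneg ⌊A⌋₊ : (0:ℝ) ≤ _)]
  have h2 : ∫ x in (0:ℝ)..⌊A⌋₊, arc A x ≤ Real.pi * A ^ 2 / 4 := by
    rw [← arc_integral A hA, ← intervalIntegral.integral_add_adjacent_intervals
      (arc_int A 0 ⌊A⌋₊) (arc_int A ⌊A⌋₊ A)]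
    have : 0 ≤ ∫ x in (⌊A⌋₊:ℝ)..A, arc A x :=
      intervalIntegral.integral_nonneg (Nat.floor_le hA) (fun x _ => arc_nonneg A x)
    linarith
  rw [h0] at h
  linarith

/-- difference bounds for the arc on `x, x+1, x+2 ≤ (1 - κ) A` -/
lemma arc_diff (A κ x : ℝ) (hA : 1 ≤ A) (hκ : 0 < κ) (hx : 0 ≤ x) (hxA : x + 2 ≤ A)
    (hκ2 : κ * A ≤ arc A (x + 2)) :
    1 / A ≤ (arc A (x+1) - arc A x) - (arc A (x+2) - arc A (x+1)) ∧
    (arc A (x+1) - arc A x) - (arc A (x+2) - arc A (x+1)) ≤ (1 / κ + 3 / κ ^ 3) / A ∧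
    |arc A (x+1) - arc A x| ≤ 1 / κ := by
  have e0 := arc_sq A x hx (by linarith)
  have e1 := arc_sq A (x+1) (by linarith) (by linarith)
  have e2 := arc_sq A (x+2) (by linarith) (by linarith)
  have m01 : arc A (x+1) ≤ arc A x := arc_anti A (Set.mem_Ici.2 hx) (Set.mem_Ici.2 (by linarith)) (by linarith)
  have m12 : arc A (x+2) ≤ arc A (x+1) :=
    arc_anti A (Set.mem_Ici.2 (by linarith)) (Set.mem_Ici.2 (by linarith)) (by linarith)
  set g0 := arc A x
  set g1 := arc A (x+1)
  set g2 := arc A (x+2)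
  have hA0 : 0 < A := by linarith
  have hκA : 0 < κ * A := by positivity
  have p2 : 0 < g2 := by linarith
  have p1 : 0 < g1 := by linarith
  have p0 : 0 < g0 := by linarith
  have g0A : g0 ≤ A := by
    apply Real.sqrt_le_iff.2 ⟨hA0.le, by nlinarith⟩
  have d1 : g1 - g0 = - (2 * x + 1) / (g0 + g1) := by
    rw [eq_div_iff (by positivity)]; linear_combination e1 - e0
  have d2 : g2 - g1 = - (2 * x + 3) / (g1 + g2) := by
    rw [eq_div_iff (by positivity)]; linear_combination e2 - e1
  have d3 : g0 - g2 = (4 * x + 4) / (g0 + g2) := by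
    rw [eq_div_iff (by positivity)]; linear_combination e0 - e2
  have D : (g1 - g0) - (g2 - g1) = 2 / (g1 + g2) + (2 * x + 1) * (g0 - g2) / ((g1 + g2) * (g0 + g1)) := by
    rw [d1, d2]; field_simp; ring
  refine ⟨?_, ?_, ?_⟩
  · rw [D]
    have t1 : 1 / A ≤ 2 / (g1 + g2) := by
      rw [div_le_div_iff₀ hA0 (by positivity)]; linarith
    have t2 : 0 ≤ (2 * x + 1) * (g0 - g2) / ((g1 + g2) * (g0 + g1)) := by
      apply div_nonneg (mul_nonneg (by linarith) (by linarith)) (by positivity)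
    linarith
  · rw [D]
    have t1 : 2 / (g1 + g2) ≤ (1 / κ) / A := by
      rw [div_div, div_le_div_iff₀ (by positivity) (by positivity)]; linarith
    have t2 : (2 * x + 1) * (g0 - g2) / ((g1 + g2) * (g0 + g1)) ≤ (3 / κ^3) / A := by
      have u1 : g0 - g2 ≤ 4 / (2 * κ) := by
        rw [d3, div_le_div_iff₀ (by positivity) (by positivity)]
        nlinarith
      have u2 : (2 * κ * A) * (2 * κ * A) ≤ (g1 + g2) * (g0 + g1) := by
        apply mul_le_mul <;> nlinarith
      calc (2 * x + 1) * (g0 - g2) / ((g1 + g2) * (g0 + g1))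
          ≤ (2 * A) * (4 / (2 * κ)) / ((2 * κ * A) * (2 * κ * A)) := by
            apply div_le_div₀ (by positivity) _ (by positivity) u2
            apply mul_le_mul (by linarith) u1 (by linarith) (by linarith)
        _ = (1 / κ^3) / A := by field_simp; try norm_num
        _ ≤ (3 / κ^3) / A := by gcongr; norm_num
    rw [add_div]; linarith
  · rw [d1, abs_div, abs_neg, abs_of_pos (by linarith : 0 < 2 * x + 1), abs_of_pos (by positivity),
      div_le_div_iff₀ (by positivity) hκ]
    nlinarith


lemma quarter_count (m M ε : ℝ) (hm : 0 < m) (hmM : m ≤ M) (hε : 0 < ε) :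
    ∃ K : ℝ, 0 ≤ K ∧ ∀ a b s : ℝ, m ≤ a → a ≤ M → m ≤ b → b ≤ M → 0 ≤ s →
      ∑ j ∈ range ⌊a * s⌋₊, (⌊(b / a) * arc (a * s) ((j:ℝ) + 1)⌋ : ℝ) ≤
        Real.pi / 4 * (a * b) * s ^ 2 - (a + b) * s / 2 + ε * s + K := by
  have hM : 0 < M := by linarith
  set η : ℝ := min (1/2) (2 * ε / (3 * M)) with hη
  have hη0 : 0 < η := lt_min (by norm_num) (by positivity)
  have hη1 : η ≤ 1/2 := min_le_left _ _
  have hη2 : η ≤ 2 * ε / (3 * M) := min_le_right _ _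
  set κ : ℝ := η / 2 with hκ
  have hκ0 : 0 < κ := by positivity
  set ε1 : ℝ := ε / (3 * M) with hε1
  have hε10 : 0 < ε1 := by positivity
  set ε2 : ℝ := ε * m / (3 * M ^ 2) with hε2
  have hε20 : 0 < ε2 := by positivity
  obtain ⟨R0, hR0, key⟩ := key_floor (m / M) ((M / m) * (1 / κ + 3 / κ ^ 3)) ((M / m) * (1 / κ)) ε1
    (by positivity) (by positivity) (by positivity) hε10
  set R1 : ℝ := R0 + 4 / η + 1 with hR1
  have hη4 : 0 < 4 / η := by positivity
  refine ⟨M * R1 / m + 1 + (M / m) / ε2, by positivity, ?_⟩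
  intro a b s ha haM hb hbM hs
  have ha0 : 0 < a := by linarith
  have hb0 : 0 < b := by linarith
  have hba : b / a ≤ M / m := div_le_div₀ hM.le hbM hm ha
  have hba' : m / M ≤ b / a := div_le_div₀ hb0.le hb ha0 haM
  have hba0 : 0 < b / a := by positivity
  set A := a * s with hA
  have hA0 : 0 ≤ A := by positivity
  have triv : ∀ t : Finset ℕ, ∑ j ∈ t, (⌊(b / a) * arc A ((j:ℝ) + 1)⌋ : ℝ) ≤
      ∑ j ∈ t, (b / a) * arc A ((j:ℝ) + 1) :=
    fun t => Finset.sum_le_sum (fun i _ => Int.floor_le _)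
  have main : (b / a) * (Real.pi * A ^ 2 / 4) = Real.pi / 4 * (a * b) * s ^ 2 := by
    rw [hA]; field_simp
  have q1 : 0 < M * R1 / m := by positivity
  have q2 : 0 < (M / m) / ε2 := by positivity
  by_cases hAR : A < R1
  · have h1 := triv (range ⌊A⌋₊)
    rw [← Finset.mul_sum] at h1
    have h2 := mul_le_mul_of_nonneg_left (arc_sum_le A hA0) hba0.le
    rw [main] at h2
    have h3 : (a + b) * s / 2 ≤ M * R1 / m := by
      have : s ≤ R1 / m := by
        rw [le_div_iff₀ hm]; nlinarith
      calc (a + b) * s / 2 ≤ (M + M) * (R1 / m) / 2 := by gcongr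
        _ = M * R1 / m := by ring
    have : 0 ≤ ε * s := by positivity
    linarith
  · push Not at hAR
    have hA1 : 1 ≤ A := by linarith
    have hAη : 4 ≤ η * A := by
      have : 4 / η ≤ A := by linarith
      rw [div_le_iff₀ hη0] at this; linarith
    set n := ⌊(1 - η) * A⌋₊ with hn
    have hnA : (n:ℝ) ≤ (1 - η) * A := Nat.floor_le (by nlinarith)
    have hnA' : (1 - η) * A < n + 1 := Nat.lt_floor_add_one _
    have hnA2 : (n:ℝ) ≤ A := by linarith
    have hdiff : ∀ i < n, 1 / A ≤ (arc A ((i:ℝ)+1+1) - arc A ((i:ℝ)+1)) - (arc A ((i:ℝ)+1+2) - arc A ((i:ℝ)+1+1)) ∧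
        (arc A ((i:ℝ)+1+1) - arc A ((i:ℝ)+1)) - (arc A ((i:ℝ)+1+2) - arc A ((i:ℝ)+1+1)) ≤ (1 / κ + 3 / κ ^ 3) / A ∧
        |arc A ((i:ℝ)+1+1) - arc A ((i:ℝ)+1)| ≤ 1 / κ := by
      intro i hi
      have hi' : (i:ℝ) + 1 ≤ n := by exact_mod_cast hi
      have hi0 : (0:ℝ) ≤ i := Nat.cast_nonneg i
      have hx : (i:ℝ) + 1 + 2 ≤ (1 - κ) * A := by
        rw [hκ]; linarith
      apply arc_diff A κ ((i:ℝ) + 1) hA1 hκ0 (by positivity)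
      · nlinarith
      · apply Real.le_sqrt_of_sq_le
        have h1 : ((i:ℝ) + 1 + 2)^2 ≤ ((1 - κ) * A)^2 := pow_le_pow_left₀ (by positivity) hx 2
        have h2 : 0 ≤ κ * (1 - κ) * A^2 := by
          have : 0 ≤ 1 - κ := by linarith
          positivity
        linarith
    have hk := key A (by linarith) n hnA2 (fun i => (b / a) * arc A ((i:ℝ) + 1))
      (by
        intro i hi
        obtain ⟨d1, d2, _⟩ := hdiff i hi
        have e : ((i + 2 : ℕ) : ℝ) + 1 = (i:ℝ) + 1 + 2 := by push_cast; ring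
        have e1 : ((i + 1 : ℕ) : ℝ) + 1 = (i:ℝ) + 1 + 1 := by push_cast; ring
        simp only [e, e1]
        set DD := (arc A ((i:ℝ)+1+1) - arc A ((i:ℝ)+1)) - (arc A ((i:ℝ)+1+2) - arc A ((i:ℝ)+1+1)) with hDD
        have eD : (b / a * arc A ((i:ℝ)+1+1) - b / a * arc A ((i:ℝ)+1)) -
          (b / a * arc A ((i:ℝ)+1+2) - b / a * arc A ((i:ℝ)+1+1)) = (b / a) * DD := by
          rw [hDD]; ring
        rw [eD]
        have hDD0 : 0 ≤ DD := le_trans (by positivity) d1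
        constructor
        · calc m / M / A = (m / M) * (1 / A) := by ring
            _ ≤ (b / a) * DD := by gcongr
        · calc (b / a) * DD ≤ (M / m) * ((1 / κ + 3 / κ ^ 3) / A) := by gcongr
            _ = _ := by ring)
      (by
        intro i hi
        obtain ⟨_, _, d3⟩ := hdiff i hi
        have e1 : ((i + 1 : ℕ) : ℝ) + 1 = (i:ℝ) + 1 + 1 := by push_cast; ring
        simp only [e1]
        rw [← mul_sub, abs_mul, abs_of_pos hba0]
        gcongr)
    have hnN : n ≤ ⌊A⌋₊ := Nat.floor_mono (by linarith)
    have h2 := triv (Finset.Ico n ⌊A⌋₊)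
    have split : ∀ g : ℕ → ℝ, ∑ i ∈ range ⌊A⌋₊, g i = ∑ i ∈ range n, g i + ∑ i ∈ Finset.Ico n ⌊A⌋₊, g i :=
      fun g => (Finset.sum_range_add_sum_Ico g hnN).symm
    have h3 := mul_le_mul_of_nonneg_left (arc_sum_le' A hA0) hba0.le
    rw [Finset.mul_sum, split] at h3
    rw [split]
    have h4 : (b / a) * (Real.pi * A ^ 2 / 4 - A / 2 + √(2 * A) / 2) =
        Real.pi / 4 * (a * b) * s ^ 2 - b * s / 2 + (b / a) * (√(2 * A) / 2) := by
      rw [← main, hA]; field_simp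
    have h5 : √(2 * A) / 2 ≤ ε2 * A + 1 / ε2 := by
      have hs0 := Real.sqrt_nonneg (2 * A)
      have hsq := Real.sq_sqrt (show 0 ≤ 2 * A by positivity)
      set y := √(2 * A)
      have : ε2 * A = ε2 * y^2 / 2 := by rw [hsq]; ring
      rw [this]
      have h6 : 0 ≤ (ε2 * y - 1) ^ 2 / (2 * ε2) := by positivity
      have h7 : (ε2 * y - 1) ^ 2 / (2 * ε2) = ε2 * y^2/2 - y + 1 / (2 * ε2) := by
        field_simp; ring
      have h8 : 1 / (2 * ε2) ≤ 1 / ε2 := by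
        apply one_div_le_one_div_of_le hε20; linarith
      linarith
    have h6 : (b / a) * (√(2 * A) / 2) ≤ (M / m) * ε2 * A + (M / m) / ε2 := by
      calc (b / a) * (√(2 * A) / 2) ≤ (M / m) * (ε2 * A + 1 / ε2) := by
            apply mul_le_mul hba h5 (by positivity) (by positivity)
        _ = _ := by ring
    have hAM : A ≤ M * s := by rw [hA]; gcongr
    have h7 : (M / m) * ε2 * A ≤ ε / 3 * s := by
      calc (M / m) * ε2 * A ≤ (M / m) * ε2 * (M * s) := by gcongr
        _ = ε / 3 * s := by rw [hε2]; field_simp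
    have h8 : ε1 * A ≤ ε / 3 * s := by
      calc ε1 * A ≤ ε1 * (M * s) := by gcongr
        _ = ε / 3 * s := by rw [hε1]; field_simp
    have h9 : η * A / 2 ≤ ε / 3 * s := by
      calc η * A / 2 ≤ (2 * ε / (3 * M)) * (M * s) / 2 := by gcongr
        _ = ε / 3 * s := by field_simp
    have hAs : A = a * s := hA
    linarith


lemma slice_count (a₁ a₂ a₃ ρ : ℝ) (h₁ : 0 < a₁) (h₂ : 0 < a₂) (h₃ : 0 < a₃) (hρ : 0 ≤ ρ) :
    (cuboidCount a₁ a₂ a₃ (Real.pi ^ 2 * ρ ^ 2) : ℝ) ≤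
      ∑ i ∈ range ⌊a₁ * ρ⌋₊, ∑ j ∈ range ⌊a₂ * (arc (a₁ * ρ) ((i:ℝ) + 1) / a₁)⌋₊,
        (⌊(a₃ / a₂) * arc (a₂ * (arc (a₁ * ρ) ((i:ℝ) + 1) / a₁)) ((j:ℝ) + 1)⌋ : ℝ) := by
  set s : ℕ → ℝ := fun i => arc (a₁ * ρ) ((i:ℝ) + 1) / a₁ with hs
  set F : Finset (Σ _ : ℕ, Σ _ : ℕ, ℕ) := (range ⌊a₁ * ρ⌋₊).sigma
    (fun i => (range ⌊a₂ * s i⌋₊).sigma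
      (fun j => range ⌊(a₃ / a₂) * arc (a₂ * s i) ((j:ℝ) + 1)⌋₊)) with hF
  have hcard : (#F : ℝ) = ∑ i ∈ range ⌊a₁ * ρ⌋₊, ∑ j ∈ range ⌊a₂ * s i⌋₊,
        (⌊(a₃ / a₂) * arc (a₂ * s i) ((j:ℝ) + 1)⌋ : ℝ) := by
    rw [hF, Finset.card_sigma, Nat.cast_sum]
    refine Finset.sum_congr rfl (fun i _ => ?_)
    rw [Finset.card_sigma, Nat.cast_sum]
    refine Finset.sum_congr rfl (fun j _ => ?_)
    rw [card_range]
    exact natCast_floor_eq_intCast_floor (mul_nonneg (by positivity) (arc_nonneg _ _))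
  change _ ≤ ∑ i ∈ range ⌊a₁ * ρ⌋₊, ∑ j ∈ range ⌊a₂ * s i⌋₊,
        (⌊(a₃ / a₂) * arc (a₂ * s i) ((j:ℝ) + 1)⌋ : ℝ)
  rw [← hcard]
  apply Nat.cast_le.2
  unfold cuboidCount
  have hmem : ∀ p : {p : ℤ × ℤ × ℤ //
    1 ≤ p.1 ∧ 1 ≤ p.2.1 ∧ 1 ≤ p.2.2 ∧
    Real.pi ^ 2 * ((p.1 : ℝ) ^ 2 / a₁ ^ 2 + (p.2.1 : ℝ) ^ 2 / a₂ ^ 2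
      + (p.2.2 : ℝ) ^ 2 / a₃ ^ 2) ≤ Real.pi ^ 2 * ρ ^ 2},
      (⟨(p.1.1 - 1).toNat, (p.1.2.1 - 1).toNat, (p.1.2.2 - 1).toNat⟩ : Σ _ : ℕ, Σ _ : ℕ, ℕ) ∈ F := by
    rintro ⟨⟨p1, p2, p3⟩, q1, q2, q3, hp⟩
    simp only at q1 q2 q3 hp
    have hp' := le_of_mul_le_mul_left hp (by positivity)
    have c1 : (1:ℝ) ≤ p1 := by exact_mod_cast q1
    have c2 : (1:ℝ) ≤ p2 := by exact_mod_cast q2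
    have c3 : (1:ℝ) ≤ p3 := by exact_mod_cast q3
    have n1 : ((p1 - 1).toNat : ℝ) + 1 = p1 := by
      have : ((p1 - 1).toNat : ℤ) + 1 = p1 := by omega
      exact_mod_cast this
    have n2 : ((p2 - 1).toNat : ℝ) + 1 = p2 := by
      have : ((p2 - 1).toNat : ℤ) + 1 = p2 := by omega
      exact_mod_cast this
    have n3 : ((p3 - 1).toNat : ℝ) + 1 = p3 := by
      have : ((p3 - 1).toNat : ℤ) + 1 = p3 := by omega
      exact_mod_cast this
    have lt_of : ∀ (u : ℕ) (X : ℝ), (u:ℝ) + 1 ≤ X → u < ⌊X⌋₊ := by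
      intro u X h
      apply Nat.lt_of_succ_le
      apply Nat.le_floor
      push_cast; exact h
    have d1 : 0 ≤ (p1:ℝ)^2 / a₁^2 := by positivity
    have d2 : 0 ≤ (p2:ℝ)^2 / a₂^2 := by positivity
    have d3 : 0 ≤ (p3:ℝ)^2 / a₃^2 := by positivity
    have b1 : (p1:ℝ) ≤ a₁ * ρ := by
      have : (p1:ℝ)^2 / a₁^2 ≤ ρ^2 := by linarith
      rw [div_le_iff₀ (by positivity)] at this
      apply abs_le_of_sq_le_sq' _ (by positivity) |>.2
      linarith
    have hs2 : (arc (a₁ * ρ) p1 / a₁)^2 = ρ^2 - (p1:ℝ)^2/a₁^2 := by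
      rw [div_pow, arc_sq _ _ (by linarith) b1]; field_simp
    have hs0 : 0 ≤ arc (a₁ * ρ) p1 / a₁ := div_nonneg (arc_nonneg _ _) h₁.le
    set σ := arc (a₁ * ρ) p1 / a₁ with hσ
    have b2 : (p2:ℝ) ≤ a₂ * σ := by
      have : (p2:ℝ)^2 / a₂^2 ≤ σ^2 := by linarith
      rw [div_le_iff₀ (by positivity)] at this
      apply abs_le_of_sq_le_sq' _ (by positivity) |>.2
      linarith
    have hτ2 := arc_sq (a₂ * σ) p2 (by linarith) b2
    have hτ0 := arc_nonneg (a₂ * σ) p2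
    have b3 : (p3:ℝ) ≤ (a₃ / a₂) * arc (a₂ * σ) p2 := by
      have : (p3:ℝ)^2 / a₃^2 ≤ σ^2 - (p2:ℝ)^2 / a₂^2 := by linarith
      rw [div_le_iff₀ (by positivity)] at this
      apply abs_le_of_sq_le_sq' _ (by positivity) |>.2
      rw [mul_pow, hτ2]
      refine this.trans (le_of_eq ?_)
      field_simp
    rw [hF, Finset.mem_sigma, Finset.mem_sigma, mem_range, mem_range, mem_range]
    simp only [hs, n1, n2]
    refine ⟨lt_of _ _ ?_, lt_of _ _ ?_, lt_of _ _ ?_⟩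
    · rw [n1]; exact b1
    · rw [n2]; exact b2
    · rw [n3]; exact b3
  have hinj := Nat.card_le_card_of_injective (fun p => (⟨_, hmem p⟩ : F)) (by
    rintro ⟨⟨p1, p2, p3⟩, q1, q2, q3, hp⟩ ⟨⟨p1', p2', p3'⟩, q1', q2', q3', hp'⟩ h
    simp only [Subtype.mk.injEq, Sigma.mk.injEq, heq_eq_eq] at h
    simp only [Subtype.mk.injEq, Prod.mk.injEq]
    simp only at q1 q2 q3 q1' q2' q3'
    omega)
  simpa using hinj

lemma sum_sq_arc (L : ℝ) (hL : 0 ≤ L) :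
    ∑ i ∈ range ⌊L⌋₊, (arc L ((i:ℝ) + 1)) ^ 2 ≤ 2 / 3 * L ^ 3 - (⌊L⌋₊ : ℝ) ^ 2 / 2 := by
  have h1 : ∑ i ∈ range ⌊L⌋₊, (arc L ((i:ℝ) + 1)) ^ 2 = ∑ i ∈ range ⌊L⌋₊, (L ^ 2 - ((i:ℝ) + 1) ^ 2) := by
    refine Finset.sum_congr rfl (fun i hi => ?_)
    rw [mem_range] at hi
    apply arc_sq _ _ (by positivity)
    have : ((i + 1 : ℕ) : ℝ) ≤ ⌊L⌋₊ := by exact_mod_cast hi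
    push_cast at this
    exact this.trans (Nat.floor_le hL)
  have h2 : ∀ n : ℕ, ∑ i ∈ range n, (L ^ 2 - ((i:ℝ) + 1) ^ 2) = n * L ^ 2 - n * (n + 1) * (2 * n + 1) / 6 := by
    intro n
    induction n with
    | zero => simp
    | succ n ih => rw [Finset.sum_range_succ, ih]; push_cast; ring
  rw [h1, h2]
  have h3 := Nat.floor_le hL
  have h4 : (0:ℝ) ≤ ⌊L⌋₊ := Nat.cast_nonneg _
  set n : ℝ := (⌊L⌋₊ : ℝ)
  have h5 : 0 ≤ (L - n)^2 * (2 * L + n) := by positivity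
  nlinarith

lemma inner_le (a b s : ℝ) (ha : 0 < a) (hb : 0 < b) (hs : 0 ≤ s) :
    ∑ j ∈ range ⌊a * s⌋₊, (⌊(b / a) * arc (a * s) ((j:ℝ) + 1)⌋ : ℝ) ≤ Real.pi / 4 * (a * b) * s ^ 2 := by
  have h1 : ∑ j ∈ range ⌊a * s⌋₊, (⌊(b / a) * arc (a * s) ((j:ℝ) + 1)⌋ : ℝ) ≤
      ∑ j ∈ range ⌊a * s⌋₊, (b / a) * arc (a * s) ((j:ℝ) + 1) :=
    Finset.sum_le_sum (fun i _ => Int.floor_le _)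
  rw [← Finset.mul_sum] at h1
  have h2 := mul_le_mul_of_nonneg_left (arc_sum_le (a * s) (by positivity)) (show 0 ≤ b / a by positivity)
  have h3 : (b / a) * (Real.pi * (a * s) ^ 2 / 4) = Real.pi / 4 * (a * b) * s ^ 2 := by field_simp
  linarith

lemma count_le_bad (a₁ a₂ a₃ ρ : ℝ) (h₁ : 0 < a₁) (h₂ : 0 < a₂) (h₃ : 0 < a₃) (hρ : 0 ≤ ρ)
    (hprod : a₁ * a₂ * a₃ = 1) (hone : 1 ≤ cuboidCount a₁ a₂ a₃ (Real.pi ^ 2 * ρ ^ 2)) :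
    (cuboidCount a₁ a₂ a₃ (Real.pi ^ 2 * ρ ^ 2) : ℝ) ≤
      Real.pi / 6 * ρ ^ 3 - Real.pi / 32 * (1 / a₁) * ρ ^ 2 := by
  have h := slice_count a₁ a₂ a₃ ρ h₁ h₂ h₃ hρ
  set L := a₁ * ρ with hL
  have hL0 : 0 ≤ L := by positivity
  have hn : 1 ≤ ⌊L⌋₊ := by
    by_contra hc
    have h0 : ⌊L⌋₊ = 0 := by omega
    rw [h0] at h
    simp only [range_zero, sum_empty] at h
    have : (1:ℝ) ≤ (cuboidCount a₁ a₂ a₃ (Real.pi ^ 2 * ρ ^ 2) : ℝ) := by exact_mod_cast hone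
    linarith
  have h2 : (cuboidCount a₁ a₂ a₃ (Real.pi ^ 2 * ρ ^ 2) : ℝ) ≤
      ∑ i ∈ range ⌊L⌋₊, Real.pi / 4 * (a₂ * a₃) * (arc L ((i:ℝ) + 1) / a₁) ^ 2 :=
    h.trans (Finset.sum_le_sum (fun i _ => inner_le a₂ a₃ _ h₂ h₃ (div_nonneg (arc_nonneg _ _) h₁.le)))
  have h3 : ∑ i ∈ range ⌊L⌋₊, Real.pi / 4 * (a₂ * a₃) * (arc L ((i:ℝ) + 1) / a₁) ^ 2 =
      Real.pi / 4 * (1 / a₁ ^ 3) * ∑ i ∈ range ⌊L⌋₊, (arc L ((i:ℝ) + 1)) ^ 2 := by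
    rw [Finset.mul_sum]
    refine Finset.sum_congr rfl (fun i _ => ?_)
    have : a₂ * a₃ = 1 / a₁ := by field_simp; linarith
    rw [this]; field_simp
  rw [h3] at h2
  have h4 := sum_sq_arc L hL0
  have h5 : L ^ 2 / 8 ≤ (⌊L⌋₊ : ℝ) ^ 2 / 2 := by
    have t1 : (1:ℝ) ≤ ⌊L⌋₊ := by exact_mod_cast hn
    have t2 := Nat.lt_floor_add_one L
    nlinarith
  have hpi := Real.pi_pos
  calc _ ≤ _ := h2
    _ ≤ Real.pi / 4 * (1 / a₁ ^ 3) * (2 / 3 * L ^ 3 - L ^ 2 / 8) := by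
      gcongr; linarith
    _ = _ := by rw [hL]; field_simp; ring

lemma count_le_good (m M ε : ℝ) (hm : 0 < m) (hmM : m ≤ M) (hε : 0 < ε) :
    ∃ ρ0 : ℝ, 0 < ρ0 ∧ ∀ ρ a₁ a₂ a₃ : ℝ, ρ0 ≤ ρ → m ≤ a₁ → a₁ ≤ M → m ≤ a₂ → a₂ ≤ M → m ≤ a₃ → a₃ ≤ M →
      a₁ * a₂ * a₃ = 1 →
      (cuboidCount a₁ a₂ a₃ (Real.pi ^ 2 * ρ ^ 2) : ℝ) ≤
      Real.pi / 6 * ρ ^ 3 - Real.pi / 8 * (1 / a₁ + 1 / a₂ + 1 / a₃) * ρ ^ 2 + ε * ρ ^ 2 := by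
  have hM : 0 < M := by linarith
  obtain ⟨K, hK, key⟩ := quarter_count m M (ε / (2 * M)) hm hmM (by positivity)
  refine ⟨2 * (1 / m ^ 2 + M + K * M) / ε, by positivity, ?_⟩
  intro ρ a₁ a₂ a₃ hρ0 l1 u1 l2 u2 l3 u3 hprod
  have hρp : 0 < ρ := lt_of_lt_of_le (by positivity) hρ0
  have hρ : 0 ≤ ρ := hρp.le
  have h₁ : 0 < a₁ := by linarith
  have h₂ : 0 < a₂ := by linarith
  have h₃ : 0 < a₃ := by linarith
  have h := slice_count a₁ a₂ a₃ ρ h₁ h₂ h₃ hρ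
  set L := a₁ * ρ with hL
  have hL0 : 0 ≤ L := by positivity
  have hpi := Real.pi_pos
  have hpi4 := Real.pi_le_four
  have h2 : (cuboidCount a₁ a₂ a₃ (Real.pi ^ 2 * ρ ^ 2) : ℝ) ≤
      ∑ i ∈ range ⌊L⌋₊, (Real.pi / 4 * (a₂ * a₃) * (arc L ((i:ℝ) + 1) / a₁) ^ 2
        - (a₂ + a₃) * (arc L ((i:ℝ) + 1) / a₁) / 2 + (ε / (2 * M)) * (arc L ((i:ℝ) + 1) / a₁) + K) :=
    h.trans (Finset.sum_le_sum (fun i _ => key a₂ a₃ _ l2 u2 l3 u3 (div_nonneg (arc_nonneg _ _) h₁.le)))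
  have h3 : ∑ i ∈ range ⌊L⌋₊, (Real.pi / 4 * (a₂ * a₃) * (arc L ((i:ℝ) + 1) / a₁) ^ 2
        - (a₂ + a₃) * (arc L ((i:ℝ) + 1) / a₁) / 2 + (ε / (2 * M)) * (arc L ((i:ℝ) + 1) / a₁) + K) =
      Real.pi / 4 * (1 / a₁ ^ 3) * ∑ i ∈ range ⌊L⌋₊, (arc L ((i:ℝ) + 1)) ^ 2
      - (a₂ + a₃) / (2 * a₁) * ∑ i ∈ range ⌊L⌋₊, arc L ((i:ℝ) + 1)
      + (ε / (2 * M)) / a₁ * ∑ i ∈ range ⌊L⌋₊, arc L ((i:ℝ) + 1) + ⌊L⌋₊ * K := by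
    rw [Finset.sum_add_distrib, Finset.sum_add_distrib, Finset.sum_sub_distrib, Finset.mul_sum,
      Finset.mul_sum, Finset.mul_sum]
    congr 1
    · congr 1
      · congr 1
        · refine Finset.sum_congr rfl (fun i _ => ?_)
          have : a₂ * a₃ = 1 / a₁ := by field_simp; linarith
          rw [this]; field_simp
        · refine Finset.sum_congr rfl (fun i _ => ?_)
          field_simp
      · refine Finset.sum_congr rfl (fun i _ => ?_)
        field_simp
    · simp
  rw [h3] at h2
  have s1 := sum_sq_arc L hL0
  have s2 := arc_sum_ge L hL0
  have s3 := arc_sum_le L hL0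
  have s4 := Nat.floor_le hL0
  have s5 : L ^ 2 / 2 - L ≤ (⌊L⌋₊ : ℝ) ^ 2 / 2 := by
    have t2 := Nat.lt_floor_add_one L
    have t1 : (0:ℝ) ≤ ⌊L⌋₊ := Nat.cast_nonneg _
    nlinarith
  have v1 : Real.pi / 4 * (1 / a₁ ^ 3) * ∑ i ∈ range ⌊L⌋₊, (arc L ((i:ℝ) + 1)) ^ 2 ≤
      Real.pi / 6 * ρ ^ 3 - Real.pi / 8 * (1 / a₁) * ρ ^ 2 + 1 / m ^ 2 * ρ := by
    calc _ ≤ Real.pi / 4 * (1 / a₁ ^ 3) * (2 / 3 * L ^ 3 - L ^ 2 / 2 + L) := by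
          gcongr; linarith
      _ = Real.pi / 6 * ρ ^ 3 - Real.pi / 8 * (1 / a₁) * ρ ^ 2 + (Real.pi / 4) * (1 / a₁ ^ 2) * ρ := by
        rw [hL]; field_simp; ring
      _ ≤ Real.pi / 6 * ρ ^ 3 - Real.pi / 8 * (1 / a₁) * ρ ^ 2 + 1 * (1 / m ^ 2) * ρ := by
        gcongr; linarith
      _ = _ := by ring
  have v2 : (a₂ + a₃) / (2 * a₁) * (Real.pi * L ^ 2 / 4 - L) ≤
      (a₂ + a₃) / (2 * a₁) * ∑ i ∈ range ⌊L⌋₊, arc L ((i:ℝ) + 1) := by gcongr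
  have v2' : (a₂ + a₃) / (2 * a₁) * (Real.pi * L ^ 2 / 4 - L) =
      Real.pi / 8 * (1 / a₂ + 1 / a₃) * ρ ^ 2 - (a₂ + a₃) / 2 * ρ := by
    have e3 : 1 / a₃ = a₁ * a₂ := by field_simp; linarith
    have e2 : 1 / a₂ = a₁ * a₃ := by field_simp; linarith
    rw [e2, e3, hL]; field_simp; ring
  have v2b : (a₂ + a₃) / 2 * ρ ≤ M * ρ := by gcongr; linarith
  have v3 : (ε / (2 * M)) / a₁ * ∑ i ∈ range ⌊L⌋₊, arc L ((i:ℝ) + 1) ≤ ε / 2 * ρ ^ 2 := by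
    calc _ ≤ (ε / (2 * M)) / a₁ * (4 * L ^ 2 / 4) := by
          gcongr; refine s3.trans ?_; gcongr
      _ = (ε / (2 * M)) * a₁ * ρ ^ 2 := by rw [hL]; field_simp
      _ ≤ (ε / (2 * M)) * M * ρ ^ 2 := by gcongr
      _ = _ := by field_simp
  have v4 : (⌊L⌋₊ : ℝ) * K ≤ K * M * ρ := by
    calc (⌊L⌋₊ : ℝ) * K ≤ (M * ρ) * K := by
          gcongr; refine s4.trans ?_; rw [hL]; gcongr
      _ = _ := by ring
  have v5 : (1 / m ^ 2 + M + K * M) * ρ ≤ ε / 2 * ρ ^ 2 := by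
    rw [div_le_iff₀ hε] at hρ0
    nlinarith
  linarith


lemma abs_le_of_sq_le_nat (N : ℕ) (x : ℤ) (r y : ℝ) (hr : 0 ≤ r) (hN : r ≤ N) (hy : 0 ≤ y)
    (h : (x:ℝ)^2 + y ≤ r^2) : x ∈ Set.Icc (-(N:ℤ)) N := by
  have h1 : |(x:ℝ)| ≤ r := abs_le_of_sq_le_sq (by linarith) hr
  have h2 : |(x:ℝ)| ≤ N := h1.trans hN
  rw [Set.mem_Icc, ← abs_le]
  exact_mod_cast h2

lemma cube_lower (r : ℝ) (hr : 0 ≤ r) :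
    Nat.card {p : ℤ × ℤ × ℤ // (p.1 : ℝ) ^ 2 + (p.2.1 : ℝ) ^ 2 + (p.2.2 : ℝ) ^ 2 ≤ r ^ 2} ≤
      8 * cuboidCount 1 1 1 (Real.pi ^ 2 * r ^ 2) +
      3 * Nat.card {p : ℤ × ℤ // (p.1 : ℝ) ^ 2 + (p.2 : ℝ) ^ 2 ≤ r ^ 2} := by
  obtain ⟨N, hN⟩ := exists_nat_ge r
  set B : Set (ℤ × ℤ × ℤ) := {p | (p.1 : ℝ) ^ 2 + (p.2.1 : ℝ) ^ 2 + (p.2.2 : ℝ) ^ 2 ≤ r ^ 2} with hB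
  set P : Set (ℤ × ℤ × ℤ) := {p | 1 ≤ p.1 ∧ 1 ≤ p.2.1 ∧ 1 ≤ p.2.2 ∧
    Real.pi ^ 2 * ((p.1 : ℝ) ^ 2 / 1 ^ 2 + (p.2.1 : ℝ) ^ 2 / 1 ^ 2
      + (p.2.2 : ℝ) ^ 2 / 1 ^ 2) ≤ Real.pi ^ 2 * r ^ 2} with hP
  set E : Set (ℤ × ℤ) := {p | (p.1 : ℝ) ^ 2 + (p.2 : ℝ) ^ 2 ≤ r ^ 2} with hE
  have e1 : Nat.card {p : ℤ × ℤ × ℤ // (p.1 : ℝ) ^ 2 + (p.2.1 : ℝ) ^ 2 + (p.2.2 : ℝ) ^ 2 ≤ r ^ 2} = B.ncard :=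
    Nat.card_coe_set_eq B
  have e2 : cuboidCount 1 1 1 (Real.pi ^ 2 * r ^ 2) = P.ncard := Nat.card_coe_set_eq P
  have e3 : Nat.card {p : ℤ × ℤ // (p.1 : ℝ) ^ 2 + (p.2 : ℝ) ^ 2 ≤ r ^ 2} = E.ncard :=
    Nat.card_coe_set_eq E
  rw [e1, e2, e3]
  have hPiff : ∀ p : ℤ × ℤ × ℤ, p ∈ P ↔ 1 ≤ p.1 ∧ 1 ≤ p.2.1 ∧ 1 ≤ p.2.2 ∧ p ∈ B := by
    intro p
    rw [hP, hB]
    simp only [Set.mem_setOf_eq, one_pow, div_one]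
    rw [mul_le_mul_iff_right₀ (by positivity)]
  have fB : B.Finite := by
    refine ((Set.finite_Icc (-(N:ℤ)) N).prod ((Set.finite_Icc (-(N:ℤ)) N).prod
      (Set.finite_Icc (-(N:ℤ)) N))).subset ?_
    rintro ⟨x, y, z⟩ h
    simp only [hB, Set.mem_setOf_eq] at h
    refine ⟨abs_le_of_sq_le_nat N x r ((y:ℝ)^2 + (z:ℝ)^2) hr hN (by positivity) (by linarith),
      abs_le_of_sq_le_nat N y r ((x:ℝ)^2 + (z:ℝ)^2) hr hN (by positivity) (by linarith),
      abs_le_of_sq_le_nat N z r ((y:ℝ)^2 + (x:ℝ)^2) hr hN (by positivity) (by linarith)⟩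
  have fE : E.Finite := by
    refine ((Set.finite_Icc (-(N:ℤ)) N).prod (Set.finite_Icc (-(N:ℤ)) N)).subset ?_
    rintro ⟨x, y⟩ h
    simp only [hE, Set.mem_setOf_eq] at h
    exact ⟨abs_le_of_sq_le_nat N x r ((y:ℝ)^2) hr hN (by positivity) (by linarith),
      abs_le_of_sq_le_nat N y r ((x:ℝ)^2) hr hN (by positivity) (by linarith)⟩
  have fP : P.Finite := fB.subset (fun p hp => ((hPiff p).1 hp).2.2.2)
  set U : Set ℤ := {1, -1} with hU
  have fU : U.Finite := by rw [hU]; exact Set.toFinite _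
  have cU : U.ncard = 2 := by rw [hU]; exact Set.ncard_pair (by norm_num)
  set V : Set ((ℤ × ℤ × ℤ) × (ℤ × ℤ × ℤ)) := (U ×ˢ (U ×ˢ U)) ×ˢ P with hV
  have fV : V.Finite := (fU.prod (fU.prod fU)).prod fP
  have cV : V.ncard = 8 * P.ncard := by
    rw [hV, Set.ncard_prod, Set.ncard_prod, Set.ncard_prod, cU]
  set g : (ℤ × ℤ × ℤ) × (ℤ × ℤ × ℤ) → ℤ × ℤ × ℤ :=
    fun q => (q.1.1 * q.2.1, q.1.2.1 * q.2.2.1, q.1.2.2 * q.2.2.2) with hg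
  set W : Set (ℤ × ℤ × ℤ) := Set.image g V ∪ (Set.image (fun q : ℤ × ℤ => ((0:ℤ), q.1, q.2)) E ∪
    (Set.image (fun q : ℤ × ℤ => (q.1, (0:ℤ), q.2)) E ∪ Set.image (fun q : ℤ × ℤ => (q.1, q.2, (0:ℤ))) E)) with hW
  have fW : W.Finite := (fV.image _).union ((fE.image _).union ((fE.image _).union (fE.image _)))
  have hsign : ∀ x : ℤ, x ≠ 0 → ∃ u ∈ U, 1 ≤ |x| ∧ u * |x| = x := by
    intro x hx
    rcases lt_or_gt_of_ne hx with h | h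
    · exact ⟨-1, by simp [hU], by rw [abs_of_neg h]; omega, by rw [abs_of_neg h]; ring⟩
    · exact ⟨1, by simp [hU], by rw [abs_of_pos h]; omega, by rw [abs_of_pos h]; ring⟩
  have hsub : B ⊆ W := by
    rintro ⟨x, y, z⟩ h
    have h' := h
    simp only [hB, Set.mem_setOf_eq] at h
    by_cases hx : x = 0
    · refine Or.inr (Or.inl ⟨(y, z), ?_, by simp [hx]⟩)
      simp only [hE, Set.mem_setOf_eq]
      nlinarith [sq_nonneg (x:ℝ)]
    by_cases hy : y = 0
    · refine Or.inr (Or.inr (Or.inl ⟨(x, z), ?_, by simp [hy]⟩))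
      simp only [hE, Set.mem_setOf_eq]
      nlinarith [sq_nonneg (y:ℝ)]
    by_cases hz : z = 0
    · refine Or.inr (Or.inr (Or.inr ⟨(x, y), ?_, by simp [hz]⟩))
      simp only [hE, Set.mem_setOf_eq]
      nlinarith [sq_nonneg (z:ℝ)]
    obtain ⟨u, hu, hu1, hu2⟩ := hsign x hx
    obtain ⟨v, hv, hv1, hv2⟩ := hsign y hy
    obtain ⟨w, hw, hw1, hw2⟩ := hsign z hz
    refine Or.inl ⟨((u, v, w), (|x|, |y|, |z|)), ⟨⟨hu, hv, hw⟩, ?_⟩, ?_⟩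
    · rw [hPiff]
      refine ⟨hu1, hv1, hw1, ?_⟩
      simp only [hB, Set.mem_setOf_eq, Int.cast_abs, sq_abs]
      exact h
    · simp only [hg, hu2, hv2, hw2]
  have c1 := Set.ncard_le_ncard hsub fW
  have c2 := Set.ncard_union_le (Set.image g V) (Set.image (fun q : ℤ × ℤ => ((0:ℤ), q.1, q.2)) E ∪
    (Set.image (fun q : ℤ × ℤ => (q.1, (0:ℤ), q.2)) E ∪ Set.image (fun q : ℤ × ℤ => (q.1, q.2, (0:ℤ))) E))
  have c3 := Set.ncard_union_le (Set.image (fun q : ℤ × ℤ => ((0:ℤ), q.1, q.2)) E)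
    (Set.image (fun q : ℤ × ℤ => (q.1, (0:ℤ), q.2)) E ∪ Set.image (fun q : ℤ × ℤ => (q.1, q.2, (0:ℤ))) E)
  have c4 := Set.ncard_union_le (Set.image (fun q : ℤ × ℤ => (q.1, (0:ℤ), q.2)) E)
    (Set.image (fun q : ℤ × ℤ => (q.1, q.2, (0:ℤ))) E)
  have i0 := Set.ncard_image_le (f := g) fV
  have i1 := Set.ncard_image_le (f := fun q : ℤ × ℤ => ((0:ℤ), q.1, q.2)) fE
  have i2 := Set.ncard_image_le (f := fun q : ℤ × ℤ => (q.1, (0:ℤ), q.2)) fE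
  have i3 := Set.ncard_image_le (f := fun q : ℤ × ℤ => (q.1, q.2, (0:ℤ))) fE
  rw [← hW] at c2
  omega

lemma rpow_small (β ε : ℝ) (hβ : β < 2) (hε : 0 < ε) :
    ∀ᶠ ρ : ℝ in Filter.atTop, ρ ^ β ≤ ε * ρ ^ 2 := by
  have h := tendsto_rpow_neg_atTop (show 0 < 2 - β by linarith)
  filter_upwards [h.eventually (gt_mem_nhds hε), Filter.eventually_gt_atTop 0] with ρ h1 h2
  have : ρ ^ β = ρ ^ (-(2 - β)) * ρ ^ 2 := by
    rw [← Real.rpow_natCast ρ 2, ← Real.rpow_add h2]; congr 1; push_cast; ring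
  rw [this]
  gcongr

lemma cube_count_lower (β C θ D ε : ℝ) (hsp : SphereRemainderPair β C)
    (hcp : CircleRemainderPair θ D) (hε : 0 < ε) :
    ∀ᶠ ρ : ℝ in Filter.atTop, Real.pi / 6 * ρ ^ 3 - (3 * Real.pi / 8 + ε) * ρ ^ 2 ≤
      (cuboidCount 1 1 1 (Real.pi ^ 2 * (ρ ^ 2 - 1)) : ℝ) := by
  obtain ⟨hβ0, hβ2, hC, hS⟩ := hsp
  obtain ⟨hθ0, hθ2, hD, hP⟩ := hcp
  have hpi := Real.pi_pos
  have hpi4 := Real.pi_le_four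
  filter_upwards [rpow_small β (ε / C) hβ2 (by positivity), rpow_small θ (ε / (3 * D)) hθ2 (by positivity),
    rpow_small 0 (ε / (C + 3 * D)) (by norm_num) (by positivity),
    rpow_small 1 (ε / 4) (by norm_num) (by positivity), Filter.eventually_ge_atTop 1] with ρ h1 h2 h3 h4 h5
  rw [Real.rpow_zero] at h3
  rw [Real.rpow_one] at h4
  have hr2 : 0 ≤ ρ ^ 2 - 1 := by nlinarith
  set r := √(ρ ^ 2 - 1) with hr
  have hr0 : 0 ≤ r := Real.sqrt_nonneg _
  have hrr : r ^ 2 = ρ ^ 2 - 1 := Real.sq_sqrt hr2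
  have hrρ : r ≤ ρ := by
    rw [hr]; exact Real.sqrt_le_iff.2 ⟨by linarith, by linarith⟩
  have hρ0 : 0 < ρ := by linarith
  have hr3 : ρ ^ 3 - 2 * ρ ≤ r ^ 3 := by
    have hlow : ρ - 1 / ρ ≤ r := by
      apply Real.le_sqrt_of_sq_le
      have e : (ρ - 1 / ρ) ^ 2 = ρ ^ 2 - 2 + 1 / ρ ^ 2 := by field_simp; ring
      have : 1 / ρ ^ 2 ≤ 1 := by rw [div_le_one (by positivity)]; nlinarith
      linarith
    have e : r ^ 3 = r * (ρ ^ 2 - 1) := by rw [← hrr]; ring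
    rw [e]
    have := mul_le_mul_of_nonneg_right hlow hr2
    have e2 : (ρ - 1 / ρ) * (ρ ^ 2 - 1) = ρ ^ 3 - 2 * ρ + 1 / ρ := by field_simp; ring
    have e3 : 0 < 1 / ρ := by positivity
    linarith
  have hc := cube_lower r hr0
  have hc' : (Nat.card {p : ℤ × ℤ × ℤ // (p.1 : ℝ) ^ 2 + (p.2.1 : ℝ) ^ 2 + (p.2.2 : ℝ) ^ 2 ≤ r ^ 2} : ℝ) ≤
      8 * (cuboidCount 1 1 1 (Real.pi ^ 2 * r ^ 2) : ℝ) +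
      3 * (Nat.card {p : ℤ × ℤ // (p.1 : ℝ) ^ 2 + (p.2 : ℝ) ^ 2 ≤ r ^ 2} : ℝ) := by exact_mod_cast hc
  have s1 := (abs_le.1 (hS r hr0)).1
  have s2 := (abs_le.1 (hP r hr0)).2
  rw [hrr] at hc' s1 s2
  have t1 : r ^ β ≤ ρ ^ β := Real.rpow_le_rpow hr0 hrρ hβ0
  have t2 : r ^ θ ≤ ρ ^ θ := Real.rpow_le_rpow hr0 hrρ hθ0
  have u1 : C * r ^ β ≤ ε * ρ ^ 2 := by
    calc C * r ^ β ≤ C * (ε / C * ρ ^ 2) := by gcongr; linarith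
      _ = _ := by field_simp
  have u2 : 3 * (D * r ^ θ) ≤ ε * ρ ^ 2 := by
    calc 3 * (D * r ^ θ) ≤ 3 * (D * (ε / (3 * D) * ρ ^ 2)) := by gcongr; linarith
      _ = _ := by field_simp
  have u3 : C + 3 * D ≤ ε * ρ ^ 2 := by
    calc C + 3 * D = (C + 3 * D) * 1 := by ring
      _ ≤ (C + 3 * D) * (ε / (C + 3 * D) * ρ ^ 2) := by gcongr
      _ = _ := by field_simp
  have u4 : 8 * Real.pi / 3 * ρ ≤ 8 / 3 * (ε * ρ ^ 2) := by
    have : Real.pi * ρ ≤ 4 * (ε / 4 * ρ ^ 2) := by gcongr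
    linarith
  have u5 := mul_le_mul_of_nonneg_left hr3 (show 0 ≤ 4 * Real.pi / 3 by positivity)
  have : 0 ≤ ε * ρ ^ 2 := by positivity
  linarith

lemma count_neg (a₁ a₂ a₃ lam : ℝ) (h : lam < 0) : cuboidCount a₁ a₂ a₃ lam = 0 := by
  unfold cuboidCount
  have : IsEmpty {p : ℤ × ℤ × ℤ //
    1 ≤ p.1 ∧ 1 ≤ p.2.1 ∧ 1 ≤ p.2.2 ∧
    Real.pi ^ 2 * ((p.1 : ℝ) ^ 2 / a₁ ^ 2 + (p.2.1 : ℝ) ^ 2 / a₂ ^ 2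
      + (p.2.2 : ℝ) ^ 2 / a₃ ^ 2) ≤ lam} := by
    refine ⟨fun p => ?_⟩
    have h1 := p.2.2.2.2
    have h2 : 0 ≤ Real.pi ^ 2 * ((p.1.1 : ℝ) ^ 2 / a₁ ^ 2 + (p.1.2.1 : ℝ) ^ 2 / a₂ ^ 2
      + (p.1.2.2 : ℝ) ^ 2 / a₃ ^ 2) := by positivity
    linarith
  exact Nat.card_of_isEmpty

lemma count_finite (a₁ a₂ a₃ lam : ℝ) (h₁ : 0 < a₁) (h₂ : 0 < a₂) (h₃ : 0 < a₃) (hl : 0 ≤ lam) :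
    Finite {p : ℤ × ℤ × ℤ //
    1 ≤ p.1 ∧ 1 ≤ p.2.1 ∧ 1 ≤ p.2.2 ∧
    Real.pi ^ 2 * ((p.1 : ℝ) ^ 2 / a₁ ^ 2 + (p.2.1 : ℝ) ^ 2 / a₂ ^ 2
      + (p.2.2 : ℝ) ^ 2 / a₃ ^ 2) ≤ lam} := by
  have bound : ∀ (a : ℝ) (x : ℤ) (y : ℝ), 0 < a → 0 ≤ y → 1 ≤ x →
      Real.pi ^ 2 * ((x:ℝ)^2 / a^2 + y) ≤ lam → x ∈ Set.Icc (1:ℤ) ⌈a * √lam⌉ := by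
    intro a x y ha hy hx h
    refine ⟨hx, ?_⟩
    have hpi : 1 ≤ Real.pi ^ 2 := by nlinarith [Real.pi_gt_three]
    have h0 : 0 ≤ (x:ℝ)^2 / a^2 + y := by positivity
    have h1 : (x:ℝ)^2 / a^2 ≤ lam := by nlinarith
    rw [div_le_iff₀ (by positivity)] at h1
    have h2 : (x:ℝ) ≤ a * √lam := by
      apply abs_le_of_sq_le_sq' _ (by positivity) |>.2
      rw [mul_pow, Real.sq_sqrt hl]; linarith
    exact_mod_cast h2.trans (Int.le_ceil _)
  refine Set.Finite.to_subtype (s := {p : ℤ × ℤ × ℤ | 1 ≤ p.1 ∧ 1 ≤ p.2.1 ∧ 1 ≤ p.2.2 ∧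
    Real.pi ^ 2 * ((p.1 : ℝ) ^ 2 / a₁ ^ 2 + (p.2.1 : ℝ) ^ 2 / a₂ ^ 2
      + (p.2.2 : ℝ) ^ 2 / a₃ ^ 2) ≤ lam}) ?_
  refine ((Set.finite_Icc (1:ℤ) ⌈a₁ * √lam⌉).prod ((Set.finite_Icc (1:ℤ) ⌈a₂ * √lam⌉).prod
      (Set.finite_Icc (1:ℤ) ⌈a₃ * √lam⌉))).subset ?_
  rintro ⟨x, y, z⟩ ⟨q1, q2, q3, h⟩
  simp only at q1 q2 q3 h
  exact ⟨bound a₁ x ((y:ℝ)^2/a₂^2 + (z:ℝ)^2/a₃^2) h₁ (by positivity) q1 (by linarith),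
    bound a₂ y ((x:ℝ)^2/a₁^2 + (z:ℝ)^2/a₃^2) h₂ (by positivity) q2 (by linarith),
    bound a₃ z ((x:ℝ)^2/a₁^2 + (y:ℝ)^2/a₂^2) h₃ (by positivity) q3 (by linarith)⟩

lemma count_nonempty (a₁ a₂ a₃ : ℝ) (h₁ : 0 < a₁) (h₂ : 0 < a₂) (h₃ : 0 < a₃) (k : ℕ) :
    {lam : ℝ | k ≤ cuboidCount a₁ a₂ a₃ lam}.Nonempty := by
  set lam := Real.pi ^ 2 * ((k : ℝ) ^ 2 / a₁ ^ 2 + 1 / a₂ ^ 2 + 1 / a₃ ^ 2) with hlam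
  refine ⟨lam, ?_⟩
  have hfin := count_finite a₁ a₂ a₃ lam h₁ h₂ h₃ (by positivity)
  have := Nat.card_le_card_of_injective (α := Fin k) (β := {p : ℤ × ℤ × ℤ //
    1 ≤ p.1 ∧ 1 ≤ p.2.1 ∧ 1 ≤ p.2.2 ∧
    Real.pi ^ 2 * ((p.1 : ℝ) ^ 2 / a₁ ^ 2 + (p.2.1 : ℝ) ^ 2 / a₂ ^ 2
      + (p.2.2 : ℝ) ^ 2 / a₃ ^ 2) ≤ lam})
    (fun i => ⟨((i.1:ℤ) + 1, 1, 1), by simp, by simp, by simp, by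
      have hi : (i.1:ℝ) + 1 ≤ k := by exact_mod_cast i.2
      rw [hlam]
      push_cast
      rw [one_pow]
      gcongr⟩) (by
      intro i j h
      simp only [Subtype.mk.injEq, Prod.mk.injEq] at h
      apply Fin.ext
      omega)
  rw [Nat.card_fin] at this
  exact this

lemma minimiser_compare (k : ℕ) (hk : 1 ≤ k) (a₁ a₂ a₃ : ℝ) (h : IsMinimiser k a₁ a₂ a₃) :
    ∃ ρ : ℝ, 0 ≤ ρ ∧ k ≤ cuboidCount a₁ a₂ a₃ (Real.pi ^ 2 * ρ ^ 2) ∧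
      cuboidCount 1 1 1 (Real.pi ^ 2 * (ρ ^ 2 - 1)) < k := by
  obtain ⟨h1, h12, h23, hp, hmin⟩ := h
  have hcube := hmin 1 1 1 one_pos le_rfl le_rfl (by norm_num)
  have hpi := Real.pi_pos
  have hne := count_nonempty a₁ a₂ a₃ h1 (by linarith) (by linarith) k
  obtain ⟨lam, hl1, hl2⟩ := exists_lt_of_csInf_lt hne
    (show cuboidEig a₁ a₂ a₃ k < cuboidEig a₁ a₂ a₃ k + Real.pi ^ 2 by
      have : 0 < Real.pi ^ 2 := by positivity
      linarith)
  have hl0 : 0 ≤ lam := by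
    by_contra hc
    push Not at hc
    have h0 : k ≤ cuboidCount a₁ a₂ a₃ lam := hl1
    rw [count_neg _ _ _ _ hc] at h0
    omega
  have hsq : Real.pi ^ 2 * (√lam / Real.pi) ^ 2 = lam := by
    rw [div_pow, Real.sq_sqrt hl0]; field_simp
  refine ⟨√lam / Real.pi, by positivity, ?_, ?_⟩
  · rw [hsq]; exact hl1
  · rw [mul_sub, hsq, mul_one]
    have hbdd : BddBelow {lam : ℝ | k ≤ cuboidCount 1 1 1 lam} := by
      refine ⟨0, fun x hx => ?_⟩
      by_contra hc
      push Not at hc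
      have h0 : k ≤ cuboidCount 1 1 1 x := hx
      rw [count_neg _ _ _ _ hc] at h0
      omega
    have hlt : lam - Real.pi ^ 2 < sInf {lam : ℝ | k ≤ cuboidCount 1 1 1 lam} := by
      have : cuboidEig 1 1 1 k = sInf {lam : ℝ | k ≤ cuboidCount 1 1 1 lam} := rfl
      rw [← this]; linarith
    have := notMem_of_lt_csInf hlt hbdd
    simpa using this

lemma amgm_near (x y z ε : ℝ) (hx : 0 < x) (hy : 0 < y) (hz : 0 < z) (hp : x * y * z = 1)
    (h : 1 / x + 1 / y + 1 / z ≤ 3 + ε) : (√(1 / x) - 1) ^ 2 ≤ ε := by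
  have hu : 0 < √(1 / x) := Real.sqrt_pos.2 (by positivity)
  have hv : 0 < √(1 / y) := Real.sqrt_pos.2 (by positivity)
  have hw : 0 < √(1 / z) := Real.sqrt_pos.2 (by positivity)
  have hu2 := Real.sq_sqrt (show 0 ≤ 1 / x by positivity)
  have hv2 := Real.sq_sqrt (show 0 ≤ 1 / y by positivity)
  have hw2 := Real.sq_sqrt (show 0 ≤ 1 / z by positivity)
  have huvw : √(1 / x) * √(1 / y) * √(1 / z) = 1 := by
    rw [← Real.sqrt_mul (by positivity), ← Real.sqrt_mul (by positivity)]
    have : 1 / x * (1 / y) * (1 / z) = 1 := by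
      rw [div_mul_div_comm, div_mul_div_comm, hp]; norm_num
    rw [this, Real.sqrt_one]
  set u := √(1 / x)
  set v := √(1 / y)
  set w := √(1 / z)
  have h1 : v * w = 1 / u := by field_simp; linarith
  have h2 : u ^ 2 + 2 * (1 / u) - 3 ≤ ε := by nlinarith [sq_nonneg (v - w)]
  have h3 : u ^ 2 + 2 * (1 / u) - 3 = (u - 1) ^ 2 + 2 * (u - 1) ^ 2 / u := by field_simp; ring
  have h4 : 0 ≤ 2 * (u - 1) ^ 2 / u := by positivity
  linarith

lemma tendsto_of_near (x y z : ℕ → ℝ)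
    (hpos : ∀ᶠ k in Filter.atTop, 0 < x k ∧ 0 < y k ∧ 0 < z k ∧ x k * y k * z k = 1)
    (h : ∀ ε > 0, ∀ᶠ k in Filter.atTop, 1 / x k + 1 / y k + 1 / z k ≤ 3 + ε) :
    Filter.Tendsto x Filter.atTop (nhds 1) := by
  have h1 : Filter.Tendsto (fun k => √(1 / x k)) Filter.atTop (nhds 1) := by
    rw [Metric.tendsto_nhds]
    intro δ hδ
    filter_upwards [hpos, h (δ ^ 2 / 4) (by positivity)] with k hk hk2
    have := amgm_near (x k) (y k) (z k) _ hk.1 hk.2.1 hk.2.2.1 hk.2.2.2 hk2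
    rw [Real.dist_eq]
    have h2 : |√(1 / x k) - 1| ≤ δ / 2 := abs_le_of_sq_le_sq (by linarith) (by positivity)
    linarith
  have h2 : Filter.Tendsto (fun k => ((√(1 / x k)) ^ 2)⁻¹) Filter.atTop (nhds 1) := by
    have := (h1.pow 2).inv₀ (by norm_num)
    simpa using this
  refine h2.congr' ?_
  filter_upwards [hpos] with k hk
  rw [Real.sq_sqrt (by have := hk.1; positivity)]
  simp

lemma main_sum_bound (β C θ D : ℝ)
    (hsp : SphereRemainderPair β C) (hcp : CircleRemainderPair θ D)
    (a₁ a₂ a₃ : ℕ → ℝ)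
    (hmin : ∀ k : ℕ, 1 ≤ k → IsMinimiser k (a₁ k) (a₂ k) (a₃ k)) (ε : ℝ) (hε : 0 < ε) :
    ∀ᶠ k in Filter.atTop, 1 / a₁ k + 1 / a₂ k + 1 / a₃ k ≤ 3 + ε := by
  have hpi := Real.pi_pos
  obtain ⟨X1, hX1⟩ := Filter.eventually_atTop.1
    (cube_count_lower β C θ D (Real.pi / 32) hsp hcp (by positivity))
  obtain ⟨X2, hX2⟩ := Filter.eventually_atTop.1
    (cube_count_lower β C θ D (Real.pi / 16 * ε) hsp hcp (by positivity))
  obtain ⟨X3, hX3, hgood⟩ := count_le_good (1/13) 169 (Real.pi / 16 * ε) (by norm_num) (by norm_num)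
    (by positivity)
  set X := max (max X1 X2) (max X3 1) with hX
  obtain ⟨K, hK⟩ := exists_nat_gt (X ^ 3)
  filter_upwards [Filter.eventually_ge_atTop (max K 1)] with k hk
  have hk1 : 1 ≤ k := le_trans (le_max_right _ _) hk
  have hkK : K ≤ k := le_trans (le_max_left _ _) hk
  obtain ⟨ρ, hρ, c1, c2⟩ := minimiser_compare k hk1 _ _ _ (hmin k hk1)
  obtain ⟨p1, h12, h23, hp, -⟩ := hmin k hk1
  have p2 : 0 < a₂ k := by linarith
  have p3 : 0 < a₃ k := by linarith
  have hb := count_le_bad (a₁ k) (a₂ k) (a₃ k) ρ p1 p2 p3 hρ hp (hk1.trans c1)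
  have c1' : (k:ℝ) ≤ cuboidCount (a₁ k) (a₂ k) (a₃ k) (Real.pi ^ 2 * ρ ^ 2) := by exact_mod_cast c1
  have c2' : (cuboidCount 1 1 1 (Real.pi ^ 2 * (ρ ^ 2 - 1)) : ℝ) ≤ k := by exact_mod_cast c2.le
  have hρX : X ≤ ρ := by
    by_contra hc
    push Not at hc
    have h1 : ρ ^ 3 ≤ X ^ 3 := pow_le_pow_left₀ hρ hc.le 3
    have h2 : (K:ℝ) ≤ k := by exact_mod_cast hkK
    have h3 : 0 ≤ Real.pi / 32 * (1 / a₁ k) * ρ ^ 2 := by positivity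
    have h4 : Real.pi / 6 * ρ ^ 3 ≤ 1 * ρ ^ 3 := by
      gcongr; linarith [Real.pi_le_four]
    linarith
  have x1 : X1 ≤ ρ := ((le_max_left _ _).trans (le_max_left _ _)).trans hρX
  have x2 : X2 ≤ ρ := ((le_max_right _ _).trans (le_max_left _ _)).trans hρX
  have x3 : X3 ≤ ρ := ((le_max_left _ _).trans (le_max_right _ _)).trans hρX
  have x4 : 1 ≤ ρ := ((le_max_right _ _).trans (le_max_right _ _)).trans hρX
  have hρ2 : 0 < Real.pi * ρ ^ 2 := by positivity
  have g1 := hX1 ρ x1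
  have hinv : 1 / a₁ k ≤ 13 := by
    have : (Real.pi * ρ ^ 2) * (1 / a₁ k) ≤ (Real.pi * ρ ^ 2) * 13 := by linarith
    exact le_of_mul_le_mul_left this hρ2
  have l1 : 1 / 13 ≤ a₁ k := by
    rw [div_le_iff₀ p1] at hinv; linarith
  have u3 : a₃ k ≤ 169 := by
    have : 1 / 13 * (1 / 13) * a₃ k ≤ a₁ k * a₂ k * a₃ k := by
      gcongr; linarith
    linarith
  have g3 := hgood ρ (a₁ k) (a₂ k) (a₃ k) x3 l1 (by linarith) (by linarith) (by linarith)
    (by linarith) u3 hp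
  have g2 := hX2 ρ x2
  have : (Real.pi * ρ ^ 2) * (1 / a₁ k + 1 / a₂ k + 1 / a₃ k) ≤ (Real.pi * ρ ^ 2) * (3 + ε) := by linarith
  exact le_of_mul_le_mul_left this hρ2

end

/-- If `(β,C)` is a sphere-remainder pair, `(θ,D)` is a circle-remainder pair and
`θ ≤ β`, then any sequence of minimisers `(a₁ k, a₂ k, a₃ k)` for `λ_k` converges to
the unit cube: each side-length tends to `1` as `k → ∞`. -/
theorem minimisers_tendsto_unit_cube (β C θ D : ℝ)
    (hsp : SphereRemainderPair β C) (hcp : CircleRemainderPair θ D) (hθβ : θ ≤ β)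
    (a₁ a₂ a₃ : ℕ → ℝ)
    (hmin : ∀ k : ℕ, 1 ≤ k → IsMinimiser k (a₁ k) (a₂ k) (a₃ k)) :
    Filter.Tendsto a₁ Filter.atTop (nhds 1) ∧
    Filter.Tendsto a₂ Filter.atTop (nhds 1) ∧
    Filter.Tendsto a₃ Filter.atTop (nhds 1) := by
  have hpos : ∀ᶠ k in Filter.atTop, 0 < a₁ k ∧ 0 < a₂ k ∧ 0 < a₃ k ∧ a₁ k * a₂ k * a₃ k = 1 := by
    filter_upwards [Filter.eventually_ge_atTop 1] with k hk
    obtain ⟨p1, h12, h23, hp, -⟩ := hmin k hk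
    exact ⟨p1, by linarith, by linarith, hp⟩
  have hsum := main_sum_bound β C θ D hsp hcp a₁ a₂ a₃ hmin
  refine ⟨tendsto_of_near a₁ a₂ a₃ hpos hsum, tendsto_of_near a₂ a₁ a₃ ?_ ?_,
    tendsto_of_near a₃ a₁ a₂ ?_ ?_⟩
  · filter_upwards [hpos] with k hk
    exact ⟨hk.2.1, hk.1, hk.2.2.1, by linarith [hk.2.2.2]⟩
  · intro ε hε
    filter_upwards [hsum ε hε] with k hk
    linarith
  · filter_upwards [hpos] with k hk
    exact ⟨hk.2.2.1, hk.1, hk.2.1, by linarith [hk.2.2.2]⟩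
  · intro ε hε
    filter_upwards [hsum ε hε] with k hk
    linarith
end

section
/- Let y ≥ 0 and a > 0 be real numbers. Then the sum over integers i with 1 ≤ i ≤ ⌊y^{1/2}/a⌋ of (y − a²i²)^{1/2} is at most (π/(4a))·y − (1/2)·y^{1/2} + (2a)^{1/2}·3^{-3/2}·y^{1/4}. -/
/-- Trapezoid comparison on the circle, through `sin t ≤ t`. -/
lemma arcsin_step (x u v : ℝ) (hx : 0 < x) (hu : 0 ≤ u) (huv : u ≤ v) (hv : v ≤ x) :
    v * Real.sqrt (x ^ 2 - u ^ 2) - u * Real.sqrt (x ^ 2 - v ^ 2)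
      ≤ x ^ 2 * (Real.arcsin (v / x) - Real.arcsin (u / x)) := by
  have key : ∀ w : ℝ, Real.sqrt (x ^ 2 - w ^ 2) = x * Real.sqrt (1 - (w / x) ^ 2) := by
    intro w
    have h : x ^ 2 - w ^ 2 = x ^ 2 * (1 - (w / x) ^ 2) := by field_simp
    rw [h, Real.sqrt_mul (by positivity), Real.sqrt_sq hx.le]
  have h1 : u / x ≤ v / x := by gcongr
  have h2 : v / x ≤ 1 := by rw [div_le_one hx]; exact hv
  have h0 : 0 ≤ u / x := by positivity
  have hs := Real.sin_le (sub_nonneg.2 (Real.arcsin_le_arcsin h1))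
  rw [Real.sin_sub, Real.sin_arcsin (by linarith) h2, Real.sin_arcsin (by linarith) (by linarith),
    Real.cos_arcsin, Real.cos_arcsin] at hs
  rw [key, key]
  have h3 := mul_le_mul_of_nonneg_left hs (sq_nonneg x)
  refine le_trans (le_of_eq ?_) h3
  field_simp

lemma partial_sum (x : ℝ) (hx : 0 < x) (k : ℕ) (hk : (k : ℝ) ≤ x) :
    2 * ∑ i ∈ Finset.Icc 1 k, Real.sqrt (x ^ 2 - (i : ℝ) ^ 2)
      ≤ x ^ 2 * Real.arcsin (k / x) + k * Real.sqrt (x ^ 2 - (k : ℝ) ^ 2) - x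
        + Real.sqrt (x ^ 2 - (k : ℝ) ^ 2) := by
  induction k with
  | zero => simp [Real.sqrt_sq hx.le]
  | succ k ih =>
    push_cast at hk
    have h := ih (by linarith)
    have hs := arcsin_step x k (k + 1) hx (by positivity) (by linarith) hk
    rw [Finset.sum_Icc_succ_top (by omega)]
    push_cast
    linarith

lemma cubic_bound (t x : ℝ) (ht : 0 ≤ t) (ht1 : t ≤ 1) (hx : 0 < x) :
    (1 - t) * Real.sqrt (x ^ 2 - (x - t) ^ 2) ≤ 2 * Real.sqrt (2 * x / 27) := by
  have h1 : (1 - t) * Real.sqrt (x ^ 2 - (x - t) ^ 2)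
      = Real.sqrt ((1 - t) ^ 2 * (x ^ 2 - (x - t) ^ 2)) := by
    rw [Real.sqrt_mul (sq_nonneg _), Real.sqrt_sq (by linarith)]
  have h2 : 2 * Real.sqrt (2 * x / 27) = Real.sqrt (2 ^ 2 * (2 * x / 27)) := by
    rw [Real.sqrt_mul (by norm_num), Real.sqrt_sq (by norm_num)]
  rw [h1, h2]
  apply Real.sqrt_le_sqrt
  have h3 : t * (1 - t) ^ 2 ≤ 4 / 27 := by
    have : 0 ≤ (4 - 3 * t) * (1 - 3 * t) ^ 2 := mul_nonneg (by linarith) (sq_nonneg _)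
    nlinarith
  have h4 := mul_le_mul_of_nonneg_right h3 (by positivity : (0 : ℝ) ≤ 2 * x)
  have h5 : 0 ≤ (1 - t) ^ 2 * t ^ 2 := by positivity
  nlinarith

lemma normalized (x : ℝ) (hx : 0 < x) :
    ∑ i ∈ Finset.Icc 1 ⌊x⌋₊, Real.sqrt (x ^ 2 - (i : ℝ) ^ 2)
      ≤ Real.pi / 4 * x ^ 2 - x / 2 + Real.sqrt (2 * x / 27) := by
  have hn : (⌊x⌋₊ : ℝ) ≤ x := Nat.floor_le hx.le
  have hn1 : x < ⌊x⌋₊ + 1 := Nat.lt_floor_add_one x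
  have h1 := partial_sum x hx ⌊x⌋₊ hn
  have h2 := arcsin_step x ⌊x⌋₊ x hx (by positivity) hn le_rfl
  have h3 := cubic_bound (x - ⌊x⌋₊) x (by linarith) (by linarith) hx
  rw [div_self hx.ne', Real.arcsin_one, sub_self, Real.sqrt_zero] at h2
  rw [sub_sub_cancel] at h3
  linarith

/-- For `y ≥ 0` and `a > 0`,
`∑_{i=1}^{⌊√y/a⌋} (y − a²i²)^{1/2} ≤ (π/(4a))y − (1/2)√y + (2a)^{1/2}·3^{-3/2}·y^{1/4}`. -/
theorem sum_sqrt_le (y a : ℝ) (hy : 0 ≤ y) (ha : 0 < a) :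
    ∑ i ∈ Finset.Icc 1 ⌊Real.sqrt y / a⌋₊, Real.sqrt (y - a ^ 2 * (i : ℝ) ^ 2)
      ≤ Real.pi / (4 * a) * y - (1 / 2) * Real.sqrt y
        + (2 * a) ^ ((1 : ℝ) / 2) * (3 : ℝ) ^ (-(3 : ℝ) / 2) * y ^ ((1 : ℝ) / 4) := by
  rcases hy.eq_or_lt with rfl | hy
  · simp
  obtain ⟨x, hx, rfl⟩ : ∃ x : ℝ, 0 < x ∧ y = (a * x) ^ 2 := by
    refine ⟨Real.sqrt y / a, by positivity, ?_⟩
    rw [mul_div_cancel₀ _ ha.ne', Real.sq_sqrt hy.le]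
  have hax : 0 < a * x := by positivity
  rw [Real.sqrt_sq hax.le, mul_div_cancel_left₀ _ ha.ne']
  have hsum : ∀ i : ℕ, Real.sqrt ((a * x) ^ 2 - a ^ 2 * (i : ℝ) ^ 2)
      = a * Real.sqrt (x ^ 2 - (i : ℝ) ^ 2) := by
    intro i
    rw [mul_pow, ← mul_sub, Real.sqrt_mul (by positivity), Real.sqrt_sq ha.le]
  simp_rw [hsum]
  rw [← Finset.mul_sum]
  have h3 : (3 : ℝ) ^ (-(3 : ℝ) / 2) = Real.sqrt (1 / 27) := by
    rw [Real.sqrt_eq_rpow, neg_div, Real.rpow_neg (by norm_num), ← Real.inv_rpow (by norm_num),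
      show (3 : ℝ) / 2 = (3 : ℕ) * (1 / 2) by norm_num, Real.rpow_mul (by norm_num),
      Real.rpow_natCast]
    norm_num
  have h4 : ((a * x) ^ 2) ^ ((1 : ℝ) / 4) = Real.sqrt (a * x) := by
    rw [Real.sqrt_eq_rpow, ← Real.rpow_natCast, ← Real.rpow_mul hax.le]
    norm_num
  have h5 : Real.sqrt (2 * a) * Real.sqrt (1 / 27) * Real.sqrt (a * x)
      = a * Real.sqrt (2 * x / 27) := by
    rw [← Real.sqrt_mul (by positivity), ← Real.sqrt_mul (by positivity),
      show 2 * a * (1 / 27) * (a * x) = a ^ 2 * (2 * x / 27) by ring,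
      Real.sqrt_mul (by positivity), Real.sqrt_sq ha.le]
  rw [h3, h4, ← Real.sqrt_eq_rpow, h5]
  refine (mul_le_mul_of_nonneg_left (normalized x hx) ha.le).trans (le_of_eq ?_)
  field_simp
end

section
/- Let y ≥ 0 and a > 0 be real numbers. Then the sum over integers i with 1 ≤ i ≤ ⌊y^{1/2}/a⌋ of (y − a²i²) is at most (2/(3a))·y^{3/2} − (1/2)·y + (a/4)·y^{1/2}. -/
theorem sum_closed (y a : ℝ) (n : ℕ) :
    ∑ i ∈ Finset.Icc 1 n, (y - a ^ 2 * (i : ℝ) ^ 2)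
      = n * y - a ^ 2 * (n * (n + 1) * (2 * n + 1) / 6) := by
  induction n with
  | zero => simp
  | succ k ih =>
    rw [Finset.sum_Icc_succ_top (by omega), ih]
    push_cast
    ring

/-- For `y ≥ 0` and `a > 0`,
`∑_{i=1}^{⌊√y/a⌋} (y − a²i²) ≤ (2/(3a))y^{3/2} − (1/2)y + (a/4)y^{1/2}`. -/
theorem sum_le (y a : ℝ) (hy : 0 ≤ y) (ha : 0 < a) :
    ∑ i ∈ Finset.Icc 1 ⌊Real.sqrt y / a⌋₊, (y - a ^ 2 * (i : ℝ) ^ 2)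
      ≤ 2 / (3 * a) * y ^ ((3 : ℝ) / 2) - (1 / 2) * y + a / 4 * Real.sqrt y := by
  rw [sum_closed]
  have hx0 : 0 ≤ Real.sqrt y / a := by positivity
  have hs : Real.sqrt y = a * (Real.sqrt y / a) := by field_simp
  have hp : y ^ ((3 : ℝ) / 2) = Real.sqrt y ^ 3 := by
    rw [Real.sqrt_eq_rpow, ← Real.rpow_natCast, ← Real.rpow_mul hy]
    norm_num
  have hy2 : y = Real.sqrt y ^ 2 := (Real.sq_sqrt hy).symm
  have hn := Nat.floor_le hx0
  rw [hp]
  generalize ⌊Real.sqrt y / a⌋₊ = n at *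
  generalize Real.sqrt y / a = x at *
  rw [hs] at hy2 ⊢
  rw [hy2]
  obtain ⟨t, rfl⟩ : ∃ t, x = n + t := ⟨x - n, by ring⟩
  have ht : 0 ≤ t := by linarith
  have hn0 : (0 : ℝ) ≤ n := n.cast_nonneg
  have h1 : 0 ≤ (n : ℝ) * (t ^ 2 - t + 5 / 12) :=
    mul_nonneg hn0 (by nlinarith [sq_nonneg (t - 1 / 2)])
  have h2 : 0 ≤ t * (2 * t ^ 2 / 3 - t / 2 + 1 / 4) :=
    mul_nonneg ht (by nlinarith [sq_nonneg (t - 3 / 8)])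
  have h3 := mul_nonneg (sq_nonneg a) (add_nonneg h1 h2)
  have h4 : 2 / (3 * a) * (a * (n + t)) ^ 3 = 2 / 3 * a ^ 2 * (n + t) ^ 3 := by
    field_simp
  rw [h4]
  linarith
end

section
/- Let y ≥ 0 and a > 0 be real numbers and let n ≥ 1 be an integer. Then the sum over integers i with 1 ≤ i ≤ ⌊y^{1/2}/a⌋ of (y − a²i²)^{n/2} is at most (√π/(2a))·(Γ((n+2)/2)/Γ((n+3)/2))·y^{(n+1)/2}, this upper bound being equal to the integral of (y − a²t²)^{n/2} over t ∈ [0, y^{1/2}/a]. -/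
theorem aux_sin (m : ℕ) : ∫ x in (0:ℝ)..Real.pi, Real.sin x ^ m
    = Real.sqrt Real.pi * (Real.Gamma (((m : ℝ) + 1) / 2) / Real.Gamma (((m : ℝ) + 2) / 2)) := by
  induction m using Nat.twoStepInduction with
  | zero =>
    have h := Real.Gamma_one_half_eq
    rw [one_div] at h
    simp [h, Real.mul_self_sqrt Real.pi_pos.le]
  | one =>
    have h : Real.Gamma (((1:ℝ) + 2) / 2) = 1 / 2 * Real.sqrt Real.pi := by
      rw [← Real.Gamma_one_half_eq, ← Real.Gamma_add_one (by norm_num)]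
      norm_num
    have hp : Real.sqrt Real.pi ≠ 0 := (Real.sqrt_pos.mpr Real.pi_pos).ne'
    simp only [Nat.cast_one, h]
    norm_num
    field_simp
  | more k ih _ =>
    rw [integral_sin_pow, ih]
    have h1 : Real.Gamma ((((k + 2 : ℕ) : ℝ) + 1) / 2)
        = (((k:ℝ) + 1) / 2) * Real.Gamma (((k:ℝ) + 1) / 2) := by
      rw [← Real.Gamma_add_one (by positivity)]
      congr 1; push_cast; ring
    have h2 : Real.Gamma ((((k + 2 : ℕ) : ℝ) + 2) / 2)
        = (((k:ℝ) + 2) / 2) * Real.Gamma (((k:ℝ) + 2) / 2) := by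
      rw [← Real.Gamma_add_one (by positivity)]
      congr 1; push_cast; ring
    have h3 : Real.Gamma (((k:ℝ) + 2) / 2) ≠ 0 := (Real.Gamma_pos_of_pos (by positivity)).ne'
    rw [h1, h2]
    simp
    field_simp

theorem aux_pow (x : ℝ) (hx : 0 ≤ x) (n : ℕ) : (x ^ 2) ^ ((n : ℝ) / 2) = x ^ n := by
  rw [← Real.rpow_natCast x 2, ← Real.rpow_mul hx, ← Real.rpow_natCast x n]
  congr 1; push_cast; ring

theorem aux_int (s a : ℝ) (hs : 0 ≤ s) (ha : 0 < a) (n : ℕ) :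
    ∫ t in (0 : ℝ)..(s / a), (s ^ 2 - a ^ 2 * t ^ 2) ^ ((n : ℝ) / 2)
      = s ^ (n + 1) / a * ∫ x in (0:ℝ)..Real.pi / 2, Real.cos x ^ (n + 1) := by
  have hc : Continuous fun t : ℝ => (s ^ 2 - a ^ 2 * t ^ 2) ^ ((n : ℝ) / 2) :=
    Continuous.rpow_const (by fun_prop) (fun _ => Or.inr (by positivity))
  have h := intervalIntegral.integral_comp_mul_deriv (a := 0) (b := Real.pi / 2)
    (f := fun x => s / a * Real.sin x) (f' := fun x => s / a * Real.cos x)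
    (g := fun t : ℝ => (s ^ 2 - a ^ 2 * t ^ 2) ^ ((n : ℝ) / 2))
    (fun x _ => (Real.hasDerivAt_sin x).const_mul _) (by fun_prop) hc
  simp only [Real.sin_zero, Real.sin_pi_div_two, mul_zero, mul_one] at h
  rw [← h, ← intervalIntegral.integral_const_mul]
  apply intervalIntegral.integral_congr
  intro x hx
  rw [Set.uIcc_of_le (by positivity)] at hx
  have hcx : 0 ≤ Real.cos x :=
    Real.cos_nonneg_of_mem_Icc ⟨by linarith [hx.1, Real.pi_pos], hx.2⟩
  have e : s ^ 2 - a ^ 2 * (s / a * Real.sin x) ^ 2 = (s * Real.cos x) ^ 2 := by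
    have := Real.sin_sq_add_cos_sq x
    field_simp
    linear_combination (-s ^ 2) * this
  simp only [Function.comp]
  rw [e, aux_pow _ (by positivity)]
  field_simp
  ring

/-- For `y ≥ 0`, `a > 0` and an integer `n ≥ 1`,
`∑_{i=1}^{⌊√y/a⌋} (y − a²i²)^{n/2} ≤ (√π/(2a))·(Γ((n+2)/2)/Γ((n+3)/2))·y^{(n+1)/2}`,
and this upper bound equals `∫₀^{√y/a} (y − a²t²)^{n/2} dt`. -/
theorem sum_pow_le_integral (y a : ℝ) (hy : 0 ≤ y) (ha : 0 < a) (n : ℕ) (hn : 1 ≤ n) :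
    (∑ i ∈ Finset.Icc 1 ⌊Real.sqrt y / a⌋₊,
        (y - a ^ 2 * (i : ℝ) ^ 2) ^ ((n : ℝ) / 2)
      ≤ Real.sqrt Real.pi / (2 * a)
        * (Real.Gamma (((n : ℝ) + 2) / 2) / Real.Gamma (((n : ℝ) + 3) / 2))
        * y ^ (((n : ℝ) + 1) / 2)) ∧
    Real.sqrt Real.pi / (2 * a)
        * (Real.Gamma (((n : ℝ) + 2) / 2) / Real.Gamma (((n : ℝ) + 3) / 2))
        * y ^ (((n : ℝ) + 1) / 2)
      = ∫ t in (0 : ℝ)..(Real.sqrt y / a), (y - a ^ 2 * t ^ 2) ^ ((n : ℝ) / 2) := by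
  obtain ⟨s, hs, rfl⟩ : ∃ s : ℝ, 0 ≤ s ∧ y = s ^ 2 :=
    ⟨Real.sqrt y, Real.sqrt_nonneg _, (Real.sq_sqrt hy).symm⟩
  rw [Real.sqrt_sq hs]
  have heq : Real.sqrt Real.pi / (2 * a)
        * (Real.Gamma (((n : ℝ) + 2) / 2) / Real.Gamma (((n : ℝ) + 3) / 2))
        * (s ^ 2) ^ (((n : ℝ) + 1) / 2)
      = ∫ t in (0 : ℝ)..(s / a), (s ^ 2 - a ^ 2 * t ^ 2) ^ ((n : ℝ) / 2) := by
    have h := aux_pow s hs (n + 1)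
    push_cast at h
    rw [aux_int s a hs ha n, EulerSine.integral_cos_pow_eq, aux_sin, h]
    push_cast
    rw [show (n:ℝ) + 1 + 1 = n + 2 by ring, show (n:ℝ) + 1 + 2 = n + 3 by ring]
    field_simp
  refine ⟨?_, heq⟩
  rw [heq]
  have hc : Continuous fun t : ℝ => (s ^ 2 - a ^ 2 * t ^ 2) ^ ((n : ℝ) / 2) :=
    Continuous.rpow_const (by fun_prop) (fun _ => Or.inr (by positivity))
  set N := ⌊s / a⌋₊ with hN
  have hNle : (N : ℝ) ≤ s / a := Nat.floor_le (by positivity)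
  have hnn : ∀ t : ℝ, 0 ≤ t → t ≤ s / a → 0 ≤ s ^ 2 - a ^ 2 * t ^ 2 := by
    intro t h0 h1
    rw [le_div_iff₀ ha] at h1
    have : (t * a) ^ 2 ≤ s ^ 2 := pow_le_pow_left₀ (by positivity) h1 2
    nlinarith
  have hanti : AntitoneOn (fun t : ℝ => (s ^ 2 - a ^ 2 * t ^ 2) ^ ((n : ℝ) / 2))
      (Set.Icc (0:ℝ) (0 + (N:ℝ))) := by
    intro u hu v hv huv
    have hu0 := hu.1
    apply Real.rpow_le_rpow (hnn v hv.1 (by linarith [hv.2])) _ (by positivity)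
    gcongr
  have h1 := hanti.sum_le_integral
  have h2 : ∑ i ∈ Finset.Icc 1 N, (s ^ 2 - a ^ 2 * (i : ℝ) ^ 2) ^ ((n : ℝ) / 2)
      = ∑ i ∈ Finset.range N, (s ^ 2 - a ^ 2 * (0 + ((i + 1 : ℕ) : ℝ)) ^ 2) ^ ((n : ℝ) / 2) := by
    rw [Finset.range_eq_Ico, Finset.sum_Ico_add' (fun i : ℕ => (s ^ 2 - a ^ 2 * (0 + (i : ℝ)) ^ 2) ^ ((n : ℝ) / 2)) 0 N 1]
    simp only [zero_add]
    rfl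
  rw [h2]
  refine h1.trans ?_
  rw [zero_add, ← intervalIntegral.integral_add_adjacent_intervals
    (hc.intervalIntegrable 0 (N:ℝ)) (hc.intervalIntegrable (N:ℝ) (s / a))]
  have h3 : 0 ≤ ∫ t in (N : ℝ)..(s / a), (s ^ 2 - a ^ 2 * t ^ 2) ^ ((n : ℝ) / 2) := by
    apply intervalIntegral.integral_nonneg hNle
    intro t ht
    exact Real.rpow_nonneg (hnn t ((Nat.cast_nonneg N).trans ht.1) ht.2) _
  linarith
end

section
/- Let 0 < a₁ ≤ a₂ ≤ a₃ be real numbers with a₁·a₂·a₃ = 1, and let λ ≥ 0. Then N(λ; a₁,a₂,a₃) ≤ λ^{3/2}/(6π²) − λ/(8π·a₁) + λ^{1/2}/(16·a₁²). -/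
lemma integral_quarter (T : ℝ) (hT : 0 ≤ T) :
    ∫ x in (0:ℝ)..T, Real.sqrt (1 - x ^ 2) ≤ Real.pi / 4 := by
  have hc : Continuous fun x : ℝ => Real.sqrt (1 - x ^ 2) := by fun_prop
  have hI : ∀ a b : ℝ, IntervalIntegrable (fun x : ℝ => Real.sqrt (1 - x ^ 2))
      MeasureTheory.volume a b := fun a b => hc.intervalIntegrable a b
  have h1 : ∫ x in (0:ℝ)..1, Real.sqrt (1 - x ^ 2) = Real.pi / 4 := by
    have h := integral_sqrt_one_sub_sq
    rw [← intervalIntegral.integral_add_adjacent_intervals (hI (-1) 0) (hI 0 1)] at h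
    have h2 : ∫ x in (-1:ℝ)..0, Real.sqrt (1 - x ^ 2) = ∫ x in (0:ℝ)..1, Real.sqrt (1 - x ^ 2) := by
      have := intervalIntegral.integral_comp_neg (a := (0:ℝ)) (b := 1)
        (fun x : ℝ => Real.sqrt (1 - x ^ 2))
      simp only [neg_zero, neg_sq] at this
      exact this.symm
    linarith
  have h3 : ∫ x in (0:ℝ)..T, Real.sqrt (1 - x ^ 2)
      ≤ ∫ x in (0:ℝ)..(max T 1), Real.sqrt (1 - x ^ 2) := by
    rw [← intervalIntegral.integral_add_adjacent_intervals (hI 0 T) (hI T (max T 1))]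
    have := intervalIntegral.integral_nonneg (μ := MeasureTheory.volume)
      (f := fun x : ℝ => Real.sqrt (1 - x ^ 2)) (le_max_left T 1)
      (fun u _ => Real.sqrt_nonneg _)
    linarith
  have h4 : ∫ x in (1:ℝ)..(max T 1), Real.sqrt (1 - x ^ 2) = 0 := by
    apply intervalIntegral.integral_zero_ae
    refine Filter.Eventually.of_forall fun x hx => ?_
    rw [Set.uIoc_of_le (le_max_right T 1)] at hx
    apply Real.sqrt_eq_zero_of_nonpos
    nlinarith [hx.1]
  rw [← intervalIntegral.integral_add_adjacent_intervals (hI 0 1) (hI 1 (max T 1)), h1, h4] at h3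
  linarith

lemma sum_slice (S b : ℝ) (hS : 0 ≤ S) (hb : 0 < b) (M : ℕ) :
    ∑ j ∈ Finset.Icc 1 M, Real.sqrt (S - (j : ℝ) ^ 2 / b ^ 2) ≤ Real.pi / 4 * S * b := by
  have hanti : AntitoneOn (fun x : ℝ => Real.sqrt (S - x ^ 2 / b ^ 2))
      (Set.Icc (0:ℝ) (0 + (M : ℝ))) := by
    intro x hx y hy hxy
    apply Real.sqrt_le_sqrt
    have : x ^ 2 ≤ y ^ 2 := pow_le_pow_left₀ hx.1 hxy 2
    have := div_le_div_of_nonneg_right this (sq_nonneg b)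
    linarith
  have h := hanti.sum_le_integral
  have e : ∑ j ∈ Finset.Icc 1 M, Real.sqrt (S - (j : ℝ) ^ 2 / b ^ 2)
      = ∑ i ∈ Finset.range M, Real.sqrt (S - (0 + ((i + 1 : ℕ) : ℝ)) ^ 2 / b ^ 2) := by
    rw [Finset.range_eq_Ico, Finset.sum_Ico_add' (fun j : ℕ => Real.sqrt (S - (0 + (j : ℝ)) ^ 2 / b ^ 2)) 0 M 1]
    simp only [zero_add]
    rfl
  rw [e]
  refine h.trans ?_
  rw [zero_add]
  rcases hS.eq_or_lt with rfl | hS'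
  · have : ∀ x : ℝ, Real.sqrt (0 - x ^ 2 / b ^ 2) = 0 := fun x => by
      apply Real.sqrt_eq_zero_of_nonpos
      have : 0 ≤ x ^ 2 / b ^ 2 := by positivity
      linarith
    simp only [this]; simp
  · have hs : 0 < Real.sqrt S := Real.sqrt_pos.2 hS'
    have hss : Real.sqrt S ^ 2 = S := Real.sq_sqrt hS
    have hr : 0 < b * Real.sqrt S := mul_pos hb hs
    have e2 : ∀ x : ℝ, Real.sqrt (S - x ^ 2 / b ^ 2)
        = Real.sqrt S * Real.sqrt (1 - (x / (b * Real.sqrt S)) ^ 2) := fun x => by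
      rw [← Real.sqrt_mul hS]
      congr 1
      rw [div_pow, mul_pow, hss]
      field_simp
    simp only [e2]
    rw [intervalIntegral.integral_const_mul,
      intervalIntegral.integral_comp_div (fun u : ℝ => Real.sqrt (1 - u ^ 2)) hr.ne', zero_div]
    have := integral_quarter ((M : ℝ) / (b * Real.sqrt S)) (by positivity)
    rw [smul_eq_mul]
    calc _ ≤ Real.sqrt S * (b * Real.sqrt S * (Real.pi / 4)) := by gcongr
      _ = Real.pi / 4 * Real.sqrt S ^ 2 * b := by ring
      _ = _ := by rw [hss]

lemma sum_sq (n : ℕ) (c : ℝ) :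
    ∑ i ∈ Finset.Icc 1 n, (c - (i : ℝ) ^ 2) = n * c - n * (n + 1) * (2 * n + 1) / 6 := by
  induction n with
  | zero => simp
  | succ k ih =>
    rw [Finset.sum_Icc_succ_top (by omega), ih]
    push_cast
    ring

lemma count_le (a b c r : ℝ) (ha : 0 < a) (hb : 0 < b) (hc : 0 < c) (hr : 0 ≤ r) :
    (Nat.card {p : ℤ × ℤ × ℤ //
    1 ≤ p.1 ∧ 1 ≤ p.2.1 ∧ 1 ≤ p.2.2 ∧
    ((p.1 : ℝ) ^ 2 / a ^ 2 + (p.2.1 : ℝ) ^ 2 / b ^ 2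
      + (p.2.2 : ℝ) ^ 2 / c ^ 2) ≤ r ^ 2} : ℝ) ≤
    ∑ i ∈ Finset.Icc 1 ⌊r * a⌋₊, ∑ j ∈ Finset.Icc 1 ⌊r * b⌋₊,
      c * Real.sqrt (r ^ 2 - (i : ℝ) ^ 2 / a ^ 2 - (j : ℝ) ^ 2 / b ^ 2) := by
  let F : Finset (Σ _ : ℕ, Σ _ : ℕ, ℕ) := (Finset.Icc 1 ⌊r * a⌋₊).sigma fun i =>
    (Finset.Icc 1 ⌊r * b⌋₊).sigma fun j =>
      Finset.Icc 1 ⌊c * Real.sqrt (r ^ 2 - (i : ℝ) ^ 2 / a ^ 2 - (j : ℝ) ^ 2 / b ^ 2)⌋₊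
  have key : ∀ x d : ℝ, 0 ≤ x → 0 < d → x ^ 2 / d ^ 2 ≤ r ^ 2 → x ≤ r * d := by
    intro x d hx hd h
    rw [← div_pow] at h
    have := (pow_le_pow_iff_left₀ (div_nonneg hx hd.le) hr two_ne_zero).1 h
    rwa [div_le_iff₀ hd] at this
  have hle : Nat.card {p : ℤ × ℤ × ℤ //
    1 ≤ p.1 ∧ 1 ≤ p.2.1 ∧ 1 ≤ p.2.2 ∧
    ((p.1 : ℝ) ^ 2 / a ^ 2 + (p.2.1 : ℝ) ^ 2 / b ^ 2
      + (p.2.2 : ℝ) ^ 2 / c ^ 2) ≤ r ^ 2} ≤ Nat.card F := by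
    refine Nat.card_le_card_of_injective (fun p =>
      ⟨⟨p.1.1.toNat, p.1.2.1.toNat, p.1.2.2.toNat⟩, ?_⟩) ?_
    · obtain ⟨⟨i, j, k⟩, hi, hj, hk, h⟩ := p
      dsimp only at hi hj hk h ⊢
      lift i to ℕ using by omega
      lift j to ℕ using by omega
      lift k to ℕ using by omega
      simp only [Int.cast_natCast] at h
      have hi0 : 0 ≤ (i : ℝ) ^ 2 / a ^ 2 := by positivity
      have hj0 : 0 ≤ (j : ℝ) ^ 2 / b ^ 2 := by positivity
      have hk0 : 0 ≤ (k : ℝ) ^ 2 / c ^ 2 := by positivity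
      simp only [F, Finset.mem_sigma, Finset.mem_Icc, Int.toNat_natCast]
      refine ⟨⟨by omega, Nat.le_floor (key _ _ (by positivity) ha (by linarith))⟩,
        ⟨by omega, Nat.le_floor (key _ _ (by positivity) hb (by linarith))⟩,
        by omega, Nat.le_floor ?_⟩
      have : (k : ℝ) / c ≤ Real.sqrt (r ^ 2 - (i : ℝ) ^ 2 / a ^ 2 - (j : ℝ) ^ 2 / b ^ 2) := by
        apply Real.le_sqrt_of_sq_le
        rw [div_pow]
        linarith
      rw [div_le_iff₀ hc] at this
      linarith
    · rintro ⟨⟨i, j, k⟩, hi, hj, hk, h⟩ ⟨⟨i', j', k'⟩, hi', hj', hk', h'⟩ he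
      simp only [Subtype.mk.injEq, Sigma.mk.injEq, heq_eq_eq] at he
      dsimp only at hi hj hk hi' hj' hk'
      simp only [Subtype.mk.injEq, Prod.mk.injEq]
      omega
  refine (Nat.cast_le.2 hle).trans ?_
  rw [Nat.card_eq_fintype_card, Fintype.card_coe]
  simp only [F, Finset.card_sigma, Nat.card_Icc, Nat.add_sub_cancel]
  push_cast
  gcongr
  exact Nat.floor_le (by positivity)

lemma poly_ineq (R : ℝ) (hR : 0 < R) (n : ℕ) (hn : n = ⌊R⌋₊) :
    (n : ℝ) * R ^ 2 - n * (n + 1) * (2 * n + 1) / 6 ≤ 2 / 3 * R ^ 3 - R ^ 2 / 2 + R / 4 := by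
  have h1 : (n : ℝ) ≤ R := hn ▸ Nat.floor_le hR.le
  obtain ⟨t, rfl⟩ : ∃ t, R = n + t := ⟨R - n, by ring⟩
  have ht : 0 ≤ t := by linarith
  have hn0 : (0 : ℝ) ≤ n := Nat.cast_nonneg n
  have p1 : 0 ≤ (n : ℝ) * (12 * t ^ 2 - 12 * t + 5) :=
    mul_nonneg hn0 (by nlinarith [sq_nonneg (2 * t - 1)])
  have p2 : 0 ≤ t * (8 * t ^ 2 - 6 * t + 3) :=
    mul_nonneg ht (by nlinarith [sq_nonneg (8 * t - 3)])
  nlinarith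

/-- For a cuboid of unit measure with sides `0 < a₁ ≤ a₂ ≤ a₃` and every `λ ≥ 0`,
`N(λ) ≤ λ^{3/2}/(6π²) − λ/(8πa₁) + λ^{1/2}/(16a₁²)`. -/
theorem counting_upper_bound (a₁ a₂ a₃ lam : ℝ) (h₁ : 0 < a₁) (h₁₂ : a₁ ≤ a₂)
    (h₂₃ : a₂ ≤ a₃) (hvol : a₁ * a₂ * a₃ = 1) (hlam : 0 ≤ lam) :
    (cuboidCount a₁ a₂ a₃ lam : ℝ)
      ≤ lam ^ ((3 : ℝ) / 2) / (6 * Real.pi ^ 2)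
        - lam / (8 * Real.pi * a₁) + Real.sqrt lam / (16 * a₁ ^ 2) := by
  have h2 : 0 < a₂ := by linarith
  have h3 : 0 < a₃ := by linarith
  have hpi := Real.pi_pos
  obtain ⟨r, hr, rfl⟩ : ∃ r : ℝ, 0 ≤ r ∧ lam = Real.pi ^ 2 * r ^ 2 := by
    refine ⟨Real.sqrt lam / Real.pi, by positivity, ?_⟩
    rw [div_pow, Real.sq_sqrt hlam]
    field_simp
  have hsq : Real.sqrt (Real.pi ^ 2 * r ^ 2) = Real.pi * r := by
    rw [← mul_pow, Real.sqrt_sq (by positivity)]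
  have hpow : (Real.pi ^ 2 * r ^ 2) ^ ((3 : ℝ) / 2) = (Real.pi * r) ^ 3 := by
    rw [← mul_pow, ← Real.rpow_natCast (Real.pi * r) 2, ← Real.rpow_mul (by positivity),
      ← Real.rpow_natCast (Real.pi * r) 3]
    norm_num
  rw [hsq, hpow]
  unfold cuboidCount
  simp only [mul_le_mul_iff_right₀ (show 0 < Real.pi ^ 2 by positivity)]
  refine (count_le a₁ a₂ a₃ r h₁ h2 h3 hr).trans ?_
  have step : ∀ i ∈ Finset.Icc 1 ⌊r * a₁⌋₊, ∑ j ∈ Finset.Icc 1 ⌊r * a₂⌋₊,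
      a₃ * Real.sqrt (r ^ 2 - (i : ℝ) ^ 2 / a₁ ^ 2 - (j : ℝ) ^ 2 / a₂ ^ 2)
      ≤ Real.pi / 4 * (a₂ * a₃) / a₁ ^ 2 * ((r * a₁) ^ 2 - (i : ℝ) ^ 2) := by
    intro i hi
    rw [Finset.mem_Icc] at hi
    have hi' : (i : ℝ) ≤ r * a₁ := (Nat.le_floor_iff (by positivity)).1 hi.2
    have hS : 0 ≤ r ^ 2 - (i : ℝ) ^ 2 / a₁ ^ 2 := by
      rw [sub_nonneg, div_le_iff₀ (by positivity), ← mul_pow]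
      gcongr
    rw [← Finset.mul_sum]
    calc _ ≤ a₃ * (Real.pi / 4 * (r ^ 2 - (i : ℝ) ^ 2 / a₁ ^ 2) * a₂) := by
          gcongr
          exact sum_slice _ _ hS h2 _
      _ = _ := by field_simp
  refine (Finset.sum_le_sum step).trans ?_
  rw [← Finset.mul_sum, sum_sq]
  rcases hr.eq_or_lt with rfl | hr'
  · simp
  have hp := poly_ineq (r * a₁) (by positivity) _ rfl
  have e : a₂ * a₃ = 1 / a₁ := by field_simp; linarith
  calc _ ≤ Real.pi / 4 * (a₂ * a₃) / a₁ ^ 2 *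
        (2 / 3 * (r * a₁) ^ 3 - (r * a₁) ^ 2 / 2 + (r * a₁) / 4) := by gcongr
    _ = _ := by
      rw [e]
      field_simp
      ring
end

section
/- Let 0 < a₁ ≤ a₂ ≤ a₃ be real numbers with a₁·a₂·a₃ = 1, and let λ ≥ 0. Then N(λ; a₁,a₂,a₃) ≤ (π·a₂·a₃/4) · Σ_{i₁=1}^{⌊a₁ λ^{1/2}/π⌋} (λ/π² − i₁²/a₁²). -/
lemma quarter_circle_integral : ∫ x in (0:ℝ)..1, √(1 - x ^ 2) = Real.pi / 4 := by
  have hc : Continuous fun x : ℝ => √(1 - x ^ 2) := by fun_prop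
  have h := integral_sqrt_one_sub_sq
  have h2 : ∫ x in (-1:ℝ)..0, √(1 - x ^ 2) = ∫ x in (0:ℝ)..1, √(1 - x ^ 2) := by
    have := intervalIntegral.integral_comp_neg (a := (0:ℝ)) (b := 1) (fun x : ℝ => √(1 - x ^ 2))
    simp at this
    exact this.symm
  have h3 := intervalIntegral.integral_add_adjacent_intervals
    (hc.intervalIntegrable (μ := MeasureTheory.volume) (-1) 0)
    (hc.intervalIntegrable (μ := MeasureTheory.volume) 0 1)
  linarith

lemma sum_quarter (s : ℝ) (hs : 0 < s) :
    ∑ j ∈ Finset.Icc 1 ⌊s⌋₊, √(1 - ((j : ℝ) / s) ^ 2) ≤ s * (Real.pi / 4) := by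
  have hc : Continuous fun x : ℝ => √(1 - x ^ 2) := by fun_prop
  have hanti : AntitoneOn (fun x : ℝ => √(1 - (x / s) ^ 2)) (Set.Icc (0:ℝ) (0 + (⌊s⌋₊ : ℕ))) := by
    intro x hx y hy hxy
    have h0 : 0 ≤ x := hx.1
    dsimp only
    gcongr
  have h := hanti.sum_le_integral
  have e : ∑ j ∈ Finset.Icc 1 ⌊s⌋₊, √(1 - ((j : ℝ) / s) ^ 2)
      = ∑ i ∈ Finset.range ⌊s⌋₊, √(1 - ((0 + ((i + 1 : ℕ) : ℝ)) / s) ^ 2) := by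
    rw [Finset.range_eq_Ico, Finset.sum_Ico_add' (fun j : ℕ => √(1 - ((0 + (j : ℝ)) / s) ^ 2)) 0 _ 1]
    simp only [zero_add]
    rfl
  rw [e]
  refine h.trans ?_
  rw [intervalIntegral.integral_comp_div (fun x : ℝ => √(1 - x ^ 2)) hs.ne', smul_eq_mul,
    ← quarter_circle_integral]
  refine mul_le_mul_of_nonneg_left ?_ hs.le
  refine intervalIntegral.integral_mono_interval (by simp) (by rw [zero_div]; positivity) ?_ ?_
    (hc.intervalIntegrable _ _)
  · rw [div_le_one hs, zero_add]
    exact Nat.floor_le hs.le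
  · exact Filter.Eventually.of_forall fun x => Real.sqrt_nonneg _

lemma planar_count (b c R : ℝ) (hb : 0 < b) (hc : 0 < c) (hR : 0 ≤ R) :
    ∑ j ∈ Finset.Icc 1 ⌊b * √R⌋₊, ((⌊c * √(R - (j : ℝ) ^ 2 / b ^ 2)⌋₊ : ℕ) : ℝ)
      ≤ Real.pi * b * c / 4 * R := by
  rcases hR.eq_or_lt with h0 | hR'
  · subst h0; simp
  have hs : 0 < √R := Real.sqrt_pos.2 hR'
  have hss : √R * √R = R := Real.mul_self_sqrt hR
  calc _ ≤ ∑ j ∈ Finset.Icc 1 ⌊b * √R⌋₊, c * √R * √(1 - ((j : ℝ) / (b * √R)) ^ 2) := by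
        refine Finset.sum_le_sum fun j _ => ?_
        refine (Nat.floor_le (by positivity)).trans (le_of_eq ?_)
        rw [mul_assoc, ← Real.sqrt_mul hR]
        congr 2
        rw [div_pow, mul_pow, Real.sq_sqrt hR]
        field_simp
    _ ≤ c * √R * (b * √R * (Real.pi / 4)) := by
        rw [← Finset.mul_sum]
        exact mul_le_mul_of_nonneg_left (sum_quarter _ (by positivity)) (by positivity)
    _ = Real.pi * b * c / 4 * (√R * √R) := by ring
    _ = _ := by rw [hss]

lemma le_mul_sqrt_aux (x a R : ℝ) (hx : 0 ≤ x) (ha : 0 < a) (h : x ^ 2 / a ^ 2 ≤ R) :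
    x ≤ a * √R := by
  rw [← div_pow] at h
  have := Real.le_sqrt_of_sq_le h
  rwa [div_le_iff₀' ha] at this

/-- For a cuboid of unit measure with sides `0 < a₁ ≤ a₂ ≤ a₃` and every `λ ≥ 0`,
`N(λ) ≤ (πa₂a₃/4)·∑_{i₁=1}^{⌊a₁√λ/π⌋}(λ/π² − i₁²/a₁²)`. -/
theorem counting_le_sum (a₁ a₂ a₃ lam : ℝ) (h₁ : 0 < a₁) (h₁₂ : a₁ ≤ a₂)
    (h₂₃ : a₂ ≤ a₃) (hvol : a₁ * a₂ * a₃ = 1) (hlam : 0 ≤ lam) :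
    (cuboidCount a₁ a₂ a₃ lam : ℝ)
      ≤ Real.pi * a₂ * a₃ / 4 *
          ∑ i ∈ Finset.Icc 1 ⌊a₁ * Real.sqrt lam / Real.pi⌋₊,
            (lam / Real.pi ^ 2 - (i : ℝ) ^ 2 / a₁ ^ 2) := by
  have h2 : 0 < a₂ := h₁.trans_le h₁₂
  have h3 : 0 < a₃ := h2.trans_le h₂₃
  have hpi := Real.pi_pos
  have hN : a₁ * √lam / Real.pi = a₁ * √(lam / Real.pi ^ 2) := by
    rw [Real.sqrt_div hlam, Real.sqrt_sq hpi.le, mul_div_assoc]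
  rw [hN]
  set L := lam / Real.pi ^ 2 with hL
  have hL0 : 0 ≤ L := by positivity
  let F : Finset (Σ _ : ℕ, Σ _ : ℕ, ℕ) :=
    (Finset.Icc 1 ⌊a₁ * √L⌋₊).sigma fun i =>
      (Finset.Icc 1 ⌊a₂ * √(L - (i : ℝ) ^ 2 / a₁ ^ 2)⌋₊).sigma fun j =>
        Finset.Icc 1 ⌊a₃ * √(L - (i : ℝ) ^ 2 / a₁ ^ 2 - (j : ℝ) ^ 2 / a₂ ^ 2)⌋₊
  have hcard : cuboidCount a₁ a₂ a₃ lam ≤ F.card := by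
    have key : ∀ p : {p : ℤ × ℤ × ℤ // 1 ≤ p.1 ∧ 1 ≤ p.2.1 ∧ 1 ≤ p.2.2 ∧
        Real.pi ^ 2 * ((p.1 : ℝ) ^ 2 / a₁ ^ 2 + (p.2.1 : ℝ) ^ 2 / a₂ ^ 2
          + (p.2.2 : ℝ) ^ 2 / a₃ ^ 2) ≤ lam},
        (⟨p.1.1.toNat, p.1.2.1.toNat, p.1.2.2.toNat⟩ : Σ _ : ℕ, Σ _ : ℕ, ℕ) ∈ F := by
      rintro ⟨⟨i, j, k⟩, hi, hj, hk, h⟩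
      dsimp only at hi hj hk h ⊢
      lift i to ℕ using by omega
      lift j to ℕ using by omega
      lift k to ℕ using by omega
      have h' : (i : ℝ) ^ 2 / a₁ ^ 2 + (j : ℝ) ^ 2 / a₂ ^ 2 + (k : ℝ) ^ 2 / a₃ ^ 2 ≤ L := by
        rw [hL, le_div_iff₀' (by positivity)]
        exact_mod_cast h
      have q1 : 0 ≤ (i : ℝ) ^ 2 / a₁ ^ 2 := by positivity
      have q2 : 0 ≤ (j : ℝ) ^ 2 / a₂ ^ 2 := by positivity
      have q3 : 0 ≤ (k : ℝ) ^ 2 / a₃ ^ 2 := by positivity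
      simp only [F, Finset.mem_sigma, Finset.mem_Icc, Int.toNat_natCast]
      refine ⟨⟨by omega, Nat.le_floor ?_⟩, ⟨by omega, Nat.le_floor ?_⟩,
        ⟨by omega, Nat.le_floor ?_⟩⟩
      · exact le_mul_sqrt_aux _ _ _ (by positivity) h₁ (by linarith)
      · exact le_mul_sqrt_aux _ _ _ (by positivity) h2 (by linarith)
      · exact le_mul_sqrt_aux _ _ _ (by positivity) h3 (by linarith)
    rw [cuboidCount, ← Nat.card_eq_finsetCard F]
    refine Nat.card_le_card_of_injective (fun p => (⟨_, key p⟩ : F)) ?_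
    rintro ⟨⟨i, j, k⟩, hi, hj, hk, h⟩ ⟨⟨i', j', k'⟩, hi', hj', hk', h'⟩ heq
    simp only [Subtype.mk.injEq, Sigma.mk.injEq, heq_eq_eq] at heq
    dsimp only at hi hj hk hi' hj' hk'
    obtain ⟨e1, e2, e3⟩ := heq
    simp only [Subtype.mk.injEq, Prod.mk.injEq]
    omega
  have hF : (F.card : ℝ) = ∑ i ∈ Finset.Icc 1 ⌊a₁ * √L⌋₊,
      ∑ j ∈ Finset.Icc 1 ⌊a₂ * √(L - (i : ℝ) ^ 2 / a₁ ^ 2)⌋₊,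
        ((⌊a₃ * √(L - (i : ℝ) ^ 2 / a₁ ^ 2 - (j : ℝ) ^ 2 / a₂ ^ 2)⌋₊ : ℕ) : ℝ) := by
    simp [F, Finset.card_sigma]
  refine (Nat.cast_le.2 hcard).trans ?_
  rw [hF, Finset.mul_sum]
  refine Finset.sum_le_sum fun i hi => planar_count a₂ a₃ _ h2 h3 ?_
  have hi' := (Nat.le_floor_iff (by positivity)).1 (Finset.mem_Icc.1 hi).2
  rw [← div_pow, sub_nonneg]
  have : (i : ℝ) / a₁ ≤ √L := by rwa [div_le_iff₀' h₁]
  exact (Real.le_sqrt (by positivity) hL0).1 this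
end
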